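/- arXiv:2310.02271 — 6 statements merged into one kernel-verified Lean document; each statement's English description precedes it below -/
import Mathlib

section
/- For every real s with −4 < s < −2 and s ≠ −3, the (absolutely convergent) integral ∫₀^∞ x^{s−1}·(cos x − 1 + x²/2) dx equals cos(πs/2)·Γ(s), where Γ denotes the Gamma function extended by analytic continuation to negative non-integer arguments. -/
open Real Filter Topology MeasureTheory

/-- Tonelli's theorem on the quadrant for a nonnegative kernel whose partial integrals are known. -/
lemma integrableOn_and_integral_eq_of_kernel {F : ℝ → ℝ → ℝ} {g h : ℝ → ℝ}
    (hF : Measurable (Function.uncurry F))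
    (hF_nonneg : ∀ x, 0 < x → ∀ t, 0 < t → 0 ≤ F x t)
    (hg : ∀ x, 0 < x → ∫ t in Set.Ioi 0, F x t = g x)
    (hF_int : ∀ t, 0 < t → IntegrableOn (fun x => F x t) (Set.Ioi 0))
    (hh : ∀ t, 0 < t → ∫ x in Set.Ioi 0, F x t = h t)
    (hh_int : IntegrableOn h (Set.Ioi 0)) :
    IntegrableOn g (Set.Ioi 0) ∧ ∫ x in Set.Ioi 0, g x = ∫ t in Set.Ioi 0, h t := by
  have hprod : Integrable (Function.uncurry F)
      ((volume.restrict (Set.Ioi 0)).prod (volume.restrict (Set.Ioi 0))) := by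
    rw [integrable_prod_iff' hF.aestronglyMeasurable]
    refine ⟨(ae_restrict_mem measurableSet_Ioi).mono fun t ht => hF_int t ht, ?_⟩
    refine hh_int.congr ?_
    filter_upwards [ae_restrict_mem measurableSet_Ioi] with t ht
    rw [← hh t ht]
    refine setIntegral_congr_fun measurableSet_Ioi fun x hx => ?_
    exact (Real.norm_of_nonneg (hF_nonneg x hx t ht)).symm
  refine ⟨hprod.integral_prod_left.congr ?_, ?_⟩
  · filter_upwards [ae_restrict_mem measurableSet_Ioi] with x hx
    exact hg x hx
  · calc ∫ x in Set.Ioi 0, g x = ∫ x in Set.Ioi 0, ∫ t in Set.Ioi 0, F x t :=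
          setIntegral_congr_fun measurableSet_Ioi fun x hx => (hg x hx).symm
      _ = ∫ t in Set.Ioi 0, ∫ x in Set.Ioi 0, F x t := integral_integral_swap hprod
      _ = ∫ t in Set.Ioi 0, h t := setIntegral_congr_fun measurableSet_Ioi fun t ht => hh t ht

lemma integrableOn_and_integral_rpow_div_one_add_sq {a : ℝ} (ha₀ : 0 < a) (ha₂ : a < 2) :
    IntegrableOn (fun t : ℝ => t ^ (a - 1) / (1 + t ^ 2)) (Set.Ioi 0) ∧
    ∫ t in Set.Ioi (0 : ℝ), t ^ (a - 1) / (1 + t ^ 2) = π / (2 * Real.sin (π * a / 2)) := by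
  have hΓ : 0 < Real.Gamma (a / 2) := Real.Gamma_pos_of_pos (by linarith)
  have hgauss : ∀ u : ℝ, 0 < u → ∫ t in Set.Ioi (0 : ℝ), t ^ (a - 1) * Real.exp (-u * (1 + t ^ 2))
      = Real.exp (-u) * u ^ (-(a / 2)) * (Real.Gamma (a / 2) / 2) := by
    intro u hu
    have h := integral_rpow_mul_exp_neg_mul_rpow (p := 2) (q := a - 1) two_pos (by linarith) hu
    calc _ = ∫ t in Set.Ioi (0 : ℝ), Real.exp (-u) * (t ^ (a - 1) * Real.exp (-u * t ^ (2 : ℝ))) := by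
          refine setIntegral_congr_fun measurableSet_Ioi fun t _ => ?_
          simp only [Real.rpow_two]
          rw [mul_left_comm, ← Real.exp_add]
          ring_nf
      _ = _ := by
          rw [integral_const_mul, h, sub_add_cancel]
          ring_nf
  have hu_int : ∫ u in Set.Ioi (0 : ℝ), Real.exp (-u) * u ^ (-(a / 2)) * (Real.Gamma (a / 2) / 2)
      = π / (2 * Real.sin (π * a / 2)) := by
    have h1 : Real.Gamma (1 - a / 2) = ∫ u in Set.Ioi (0 : ℝ), Real.exp (-u) * u ^ (-(a / 2)) := by
      rw [Real.Gamma_eq_integral (by linarith)]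
      ring_nf
    have h2 := Real.Gamma_mul_Gamma_one_sub (a / 2)
    rw [integral_mul_const, ← h1, mul_div_assoc π a 2, mul_comm (2 : ℝ), ← div_div, ← h2]
    ring
  have hsin : 0 < Real.sin (π * a / 2) :=
    Real.sin_pos_of_pos_of_lt_pi (by positivity) (by nlinarith [Real.pi_pos])
  rw [← hu_int]
  refine integrableOn_and_integral_eq_of_kernel
    (F := fun t u => t ^ (a - 1) * Real.exp (-u * (1 + t ^ 2))) ?_ ?_ ?_ ?_ hgauss ?_
  · unfold Function.uncurry
    fun_prop
  · intro t ht u _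
    positivity
  · intro t _
    have h : (0 : ℝ) < 1 + t ^ 2 := by positivity
    have h1 := integral_exp_mul_Ioi (neg_lt_zero.mpr h) 0
    rw [integral_const_mul]
    simp_rw [neg_mul, mul_comm _ (1 + t ^ 2), ← neg_mul]
    rw [h1]
    simp [div_eq_mul_inv, neg_add_rev, ← inv_neg]
  · intro u hu
    refine Integrable.of_integral_ne_zero ?_
    rw [hgauss u hu]
    positivity
  · refine Integrable.of_integral_ne_zero ?_
    rw [hu_int]
    positivity

lemma integrableOn_and_integral_exp_mul_cos_sub_taylor {t : ℝ} (ht : 0 < t) :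
    IntegrableOn (fun x : ℝ => Real.exp (-t * x) * (Real.cos x - 1 + x ^ 2 / 2)) (Set.Ioi 0) ∧
    ∫ x in Set.Ioi (0 : ℝ), Real.exp (-t * x) * (Real.cos x - 1 + x ^ 2 / 2)
      = 1 / (t ^ 3 * (1 + t ^ 2)) := by
  set G : ℝ → ℝ := fun x => Real.exp (-t * x) * ((Real.sin x - t * Real.cos x) / (1 + t ^ 2)
    + 1 / t - (x ^ 2 / (2 * t) + x / t ^ 2 + 1 / t ^ 3)) with hG
  have h1 : (1 + t ^ 2 : ℝ) ≠ 0 := by positivity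
  have hderiv : ∀ x ∈ Set.Ici (0 : ℝ),
      HasDerivAt G (Real.exp (-t * x) * (Real.cos x - 1 + x ^ 2 / 2)) x := by
    intro x _
    have hexp : HasDerivAt (fun x => Real.exp (-t * x)) (Real.exp (-t * x) * (-t * 1)) x :=
      ((hasDerivAt_id x).const_mul (-t)).exp
    have htrig := (((Real.hasDerivAt_sin x).sub ((Real.hasDerivAt_cos x).const_mul t)).div_const
      (1 + t ^ 2)).add_const (1 / t)
    have hpoly := ((((hasDerivAt_id x).pow 2).div_const (2 * t)).add
      ((hasDerivAt_id x).div_const (t ^ 2))).add_const (1 / t ^ 3)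
    refine (hexp.mul (htrig.sub hpoly)).congr_deriv ?_
    simp
    field_simp
    ring
  have hlim : Tendsto G atTop (𝓝 0) := by
    have hpow : ∀ n : ℕ, Tendsto (fun x : ℝ => x ^ n * Real.exp (-t * x)) atTop (𝓝 0) := fun n => by
      simpa using tendsto_rpow_mul_exp_neg_mul_atTop_nhds_zero n t ht
    have hbdd : Tendsto (fun x => Real.exp (-t * x) * ((Real.sin x - t * Real.cos x) / (1 + t ^ 2)))
        atTop (𝓝 0) := by
      refine Tendsto.zero_mul_isBoundedUnder_le (by simpa using hpow 0) ?_
      refine isBoundedUnder_of ⟨(1 + t) / (1 + t ^ 2), fun x => ?_⟩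
      simp only [Function.comp_apply, Real.norm_eq_abs, abs_div]
      rw [abs_of_pos (by positivity : (0 : ℝ) < 1 + t ^ 2)]
      gcongr
      refine (abs_sub _ _).trans (add_le_add (Real.abs_sin_le_one x) ?_)
      rw [abs_mul, abs_of_pos ht]
      exact mul_le_of_le_one_right ht.le (Real.abs_cos_le_one x)
    have h := (hbdd.add ((hpow 0).mul_const (1 / t - 1 / t ^ 3))).sub
      (((hpow 2).mul_const (1 / (2 * t))).add ((hpow 1).mul_const (1 / t ^ 2)))
    simp only [zero_mul, add_zero, sub_zero] at h
    refine h.congr fun x => ?_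
    simp only [hG]
    ring
  have hnonneg : ∀ x ∈ Set.Ioi (0 : ℝ), 0 ≤ Real.exp (-t * x) * (Real.cos x - 1 + x ^ 2 / 2) :=
    fun x _ => mul_nonneg (Real.exp_pos _).le
      (by linarith [Real.one_sub_sq_div_two_le_cos (x := x)])
  refine ⟨integrableOn_Ioi_deriv_of_nonneg' hderiv hnonneg hlim, ?_⟩
  rw [integral_Ioi_of_hasDerivAt_of_nonneg' hderiv hnonneg hlim]
  simp only [hG, mul_zero, Real.exp_zero, Real.sin_zero, Real.cos_zero]
  field_simp
  ring

/-- **A Mellin-type integral formula.**  For `−4 < s < −2`, `s ≠ −3`, the integral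
`∫₀^∞ x^{s−1}(cos x − 1 + x²/2) dx` converges absolutely and equals `cos(πs/2) Γ(s)`. -/
theorem mellin_cos_formula (s : ℝ) (hs₁ : -4 < s) (hs₂ : s < -2) (hs₃ : s ≠ -3) :
    IntegrableOn (fun x : ℝ => x ^ (s - 1) * (Real.cos x - 1 + x ^ 2 / 2)) (Set.Ioi 0) ∧
    ∫ x in Set.Ioi (0 : ℝ), x ^ (s - 1) * (Real.cos x - 1 + x ^ 2 / 2)
      = Real.cos (π * s / 2) * Real.Gamma s := by
  have hΓ : 0 < Real.Gamma (1 - s) := Real.Gamma_pos_of_pos (by linarith)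
  obtain ⟨hbeta_int, hbeta⟩ := integrableOn_and_integral_rpow_div_one_add_sq
    (a := -s - 2) (by linarith) (by linarith)
  have key := integrableOn_and_integral_eq_of_kernel
    (F := fun x t => t ^ (-s) / Real.Gamma (1 - s) *
      (Real.exp (-t * x) * (Real.cos x - 1 + x ^ 2 / 2)))
    (g := fun x => x ^ (s - 1) * (Real.cos x - 1 + x ^ 2 / 2))
    (h := fun t => t ^ (-s - 2 - 1) / (1 + t ^ 2) / Real.Gamma (1 - s))
    (by unfold Function.uncurry; fun_prop)
    (fun x _ t ht => mul_nonneg (by positivity) (mul_nonneg (Real.exp_pos _).le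
      (by linarith [Real.one_sub_sq_div_two_le_cos (x := x)])))
    (fun x hx => by
      have h := Real.integral_rpow_mul_exp_neg_mul_Ioi (a := 1 - s) (by linarith) hx
      calc _ = ∫ t in Set.Ioi (0 : ℝ), (Real.cos x - 1 + x ^ 2 / 2) / Real.Gamma (1 - s) *
              (t ^ (1 - s - 1) * Real.exp (-(x * t))) := by
            refine setIntegral_congr_fun measurableSet_Ioi fun t _ => ?_
            ring_nf
        _ = _ := by
            rw [integral_const_mul, h, one_div, Real.inv_rpow hx.le, ← Real.rpow_neg hx.le,
              neg_sub]
            field_simp)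
    (fun t ht => (integrableOn_and_integral_exp_mul_cos_sub_taylor ht).1.const_mul _)
    (fun t ht => by
      rw [integral_const_mul, (integrableOn_and_integral_exp_mul_cos_sub_taylor ht).2,
        show -s - 2 - 1 = -s - (3 : ℕ) by push_cast; ring, Real.rpow_sub_natCast ht.ne']
      field_simp)
    (hbeta_int.div_const _)
  refine ⟨key.1, key.2.trans ?_⟩
  rw [integral_div, hbeta]
  have hangle : π * (-s - 2) / 2 = -(π * s / 2 + π) := by ring
  have hsin : Real.sin (π * (-s - 2) / 2) = Real.sin (π * s / 2) := by
    rw [hangle, Real.sin_neg, Real.sin_add_pi, neg_neg]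
  have hsin_pos : 0 < Real.sin (π * s / 2) := by
    rw [← hsin]
    exact Real.sin_pos_of_pos_of_lt_pi (by nlinarith [Real.pi_pos]) (by nlinarith [Real.pi_pos])
  have hcos : Real.cos (π * s / 2) ≠ 0 := by
    intro h
    have hcos' : Real.sin (π * (s + 3) / 2) = 0 := by
      rw [show π * (s + 3) / 2 = π * s / 2 - π / 2 + 2 * π by ring, Real.sin_add_two_pi,
        Real.sin_sub_pi_div_two, h, neg_zero]
    rw [Real.sin_eq_zero_iff_of_lt_of_lt (by nlinarith [Real.pi_pos])
      (by nlinarith [Real.pi_pos])] at hcos'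
    have : π * (s + 3) = 0 := by linarith
    rcases mul_eq_zero.mp this with h | h
    · exact Real.pi_ne_zero h
    · exact hs₃ (by linarith)
  have hreflect := Real.Gamma_mul_Gamma_one_sub s
  rw [show π * s = 2 * (π * s / 2) by ring, Real.sin_two_mul] at hreflect
  rw [hsin, div_div, div_eq_iff (by positivity)]
  rw [eq_div_iff (by positivity)] at hreflect
  linear_combination -hreflect
end

section
/- Let N ≥ 2 be an integer, L = N − 1, a = π/L, κ > 1, and let φ: ℝ → ℝ be the unique strictly increasing real-analytic function satisfying κ·tan(a(s − φ(s))) = tan(π·φ(s)) (where defined) and φ(s+N) = φ(s) + 1 for all s. Let c > 0 and define x_j(t) = j − φ(j − c t) for j ∈ ℤ, t ∈ ℝ. Then: (i) the traveling-wave symmetry x_{j+1}(t + 1/c) = x_j(t) + 1 holds for all j ∈ ℤ and t ∈ ℝ; (ii) the periodicity x_{j+N}(t) = x_j(t) + L holds for all j and t; and (iii) x_j(t) < x_{j+1}(t) < … < x_{j+N}(t) = x_j(t) + L for all j and t. -/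
open Real Filter Topology

/-- `IsProfile N κ φ`: `φ` is a strictly increasing, real-analytic function on `ℝ`
satisfying `κ tan(a(s − φ(s))) = tan(π φ(s))` (with `a = π/(N−1)`) wherever both
tangents are defined, together with `φ(s+N) = φ(s) + 1`. -/
def IsProfile (N : ℕ) (κ : ℝ) (φ : ℝ → ℝ) : Prop :=
  StrictMono φ ∧ AnalyticOnNhd ℝ φ Set.univ ∧
    (∀ s : ℝ, Real.cos ((π / ((N : ℝ) - 1)) * (s - φ s)) ≠ 0 →
      Real.cos (π * φ s) ≠ 0 →
      κ * Real.tan ((π / ((N : ℝ) - 1)) * (s - φ s)) = Real.tan (π * φ s)) ∧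
    (∀ s : ℝ, φ (s + (N : ℝ)) = φ s + 1)

/-- **Symmetries of the periodic traveling wave.**
With `φ` the periodic wave profile and `x_j(t) = j − φ(j − c t)`:
(i) `x_{j+1}(t + 1/c) = x_j(t) + 1`; (ii) `x_{j+N}(t) = x_j(t) + L`;
(iii) `x_j(t) < x_{j+1}(t)` and `x_{j+N}(t) = x_j(t) + L`. -/
theorem periodic_wave_symmetries (N : ℕ) (hN : 2 ≤ N) (κ : ℝ) (hκ : 1 < κ)
    (φ : ℝ → ℝ) (hφ : IsProfile N κ φ) (c : ℝ) (hc : 0 < c)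
    (x : ℤ → ℝ → ℝ) (hx : ∀ (j : ℤ) (t : ℝ), x j t = (j : ℝ) - φ ((j : ℝ) - c * t)) :
    (∀ (j : ℤ) (t : ℝ), x (j + 1) (t + 1 / c) = x j t + 1) ∧
    (∀ (j : ℤ) (t : ℝ), x (j + (N : ℤ)) t = x j t + ((N : ℝ) - 1)) ∧
    (∀ (j : ℤ) (t : ℝ), x j t < x (j + 1) t) := by
  obtain ⟨hmono, -, -, hper⟩ := hφ
  refine ⟨fun j t => ?_, fun j t => ?_, fun j t => ?_⟩
  · have h : ((j + 1 : ℤ) : ℝ) - c * (t + 1 / c) = (j : ℝ) - c * t := by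
      push_cast
      field_simp
      ring
    rw [hx, hx, h]
    push_cast
    ring
  · have h : ((j + (N : ℤ) : ℤ) : ℝ) - c * t = ((j : ℝ) - c * t) + (N : ℝ) := by
      push_cast
      ring
    rw [hx, hx, h, hper]
    push_cast
    ring
  · have hN' : (2 : ℝ) ≤ (N : ℝ) := by exact_mod_cast hN
    have hlt : φ ((j : ℝ) + 1 - c * t) < φ ((j : ℝ) - c * t + (N : ℝ)) :=
      hmono (by linarith)
    rw [hper] at hlt
    rw [hx, hx]
    push_cast
    linarith
end

section
/- Let N ≥ 2 be an integer, L = N − 1, a = π/L, κ > 1, and let φ: ℝ → ℝ be the unique strictly increasing real-analytic function satisfying κ·tan(a(s − φ(s))) = tan(π·φ(s)) (where defined) and φ(s+N) = φ(s) + 1 for all s. Let c > 0, x_j(t) = j − φ(j − c t), and z_j(t) = exp(2·i·a·x_j(t)) ∈ ℂ. Set ν = (κ−1)/(κ+1) and σ(t) = exp(2·i·a·c·t). Then for every t ∈ ℝ, the N complex numbers z_1(t), …, z_N(t) are pairwise distinct and each is a root of the polynomial P(z) = z^N − ν·σ(t)·z^{N−1} + ν·z − σ(t); in particular P(z) = ∏_{k=1}^N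 (z − z_k(t)). -/
open Real Filter Topology

/-- A continuous function that increases by `π` somewhere has non-vanishing cosine somewhere. -/
lemma exists_cos_ne_zero_of_add_pi {f : ℝ → ℝ} (hf : Continuous f) {p : ℝ}
    (hp : f p = f 0 + π) : ∃ s, Real.cos (f s) ≠ 0 := by
  have hpi := Real.pi_pos
  have h₁ : f 0 ≤ ⌈f 0 / π⌉ * π := (div_le_iff₀ hpi).1 (Int.le_ceil _)
  have h₂ : ⌈f 0 / π⌉ * π ≤ f p := by
    rw [hp]
    have := (Int.ceil_lt_add_one (f 0 / π)).le
    calc ⌈f 0 / π⌉ * π ≤ (f 0 / π + 1) * π := by gcongr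
      _ = f 0 + π := by field_simp
  obtain ⟨s, hs⟩ := mem_range_of_exists_le_of_exists_ge hf ⟨0, h₁⟩ ⟨p, h₂⟩
  refine ⟨s, fun h => ?_⟩
  have h₀ : Real.sin (f s) = 0 := by rw [hs]; exact Real.sin_int_mul_pi _
  have := Real.sin_sq_add_cos_sq (f s)
  simp [h, h₀] at this

/-- The profile equation with denominators cleared holds on all of `ℝ`. -/
lemma IsProfile.sin_mul_cos_eq {N : ℕ} (hN : 2 ≤ N) {κ : ℝ} {φ : ℝ → ℝ}
    (hφ : IsProfile N κ φ) (s : ℝ) :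
    κ * (Real.sin ((π / ((N : ℝ) - 1)) * (s - φ s)) * Real.cos (π * φ s)) =
      Real.cos ((π / ((N : ℝ) - 1)) * (s - φ s)) * Real.sin (π * φ s) := by
  obtain ⟨-, han, htan, hper⟩ := hφ
  have hL : (N : ℝ) - 1 ≠ 0 := by
    have : (2 : ℝ) ≤ N := by exact_mod_cast hN
    linarith
  set u : ℝ → ℝ := fun s => (π / ((N : ℝ) - 1)) * (s - φ s) with hu
  set v : ℝ → ℝ := fun s => π * φ s with hv
  have hua : AnalyticOnNhd ℝ u Set.univ :=
    analyticOnNhd_const.mul (analyticOnNhd_id.sub han)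
  have hva : AnalyticOnNhd ℝ v Set.univ := analyticOnNhd_const.mul han
  have hsin {f : ℝ → ℝ} (hf : AnalyticOnNhd ℝ f Set.univ) :
      AnalyticOnNhd ℝ (fun s => Real.sin (f s)) Set.univ := fun s hs =>
    Real.analyticAt_sin.comp (hf s hs)
  have hcos {f : ℝ → ℝ} (hf : AnalyticOnNhd ℝ f Set.univ) :
      AnalyticOnNhd ℝ (fun s => Real.cos (f s)) Set.univ := fun s hs =>
    Real.analyticAt_cos.comp (hf s hs)
  have hper₀ : φ N = φ 0 + 1 := by simpa using hper 0
  obtain ⟨s₁, hs₁⟩ := exists_cos_ne_zero_of_add_pi (f := u) (p := N)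
    (continuousOn_univ.1 hua.continuousOn) (by simp only [hu, hper₀]; field_simp; ring)
  obtain ⟨s₂, hs₂⟩ := exists_cos_ne_zero_of_add_pi (f := v) (p := N)
    (continuousOn_univ.1 hva.continuousOn) (by simp only [hv, hper₀]; ring)
  have hH : AnalyticOnNhd ℝ (fun s => κ * (Real.sin (u s) * Real.cos (v s)) -
      Real.cos (u s) * Real.sin (v s)) Set.univ :=
    (analyticOnNhd_const.mul ((hsin hua).mul (hcos hva))).sub ((hcos hua).mul (hsin hva))
  have hprod : ∀ s ∈ Set.univ, Real.cos (u s) * (Real.cos (v s) *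
      (κ * (Real.sin (u s) * Real.cos (v s)) - Real.cos (u s) * Real.sin (v s))) = 0 := by
    intro s _
    by_cases h₁ : Real.cos (u s) = 0
    · simp [h₁]
    by_cases h₂ : Real.cos (v s) = 0
    · simp [h₂]
    have h := htan s h₁ h₂
    rw [Real.tan_eq_sin_div_cos, Real.tan_eq_sin_div_cos] at h
    change κ * (Real.sin (u s) / Real.cos (u s)) = Real.sin (v s) / Real.cos (v s) at h
    field_simp at h
    rw [mul_eq_zero, mul_eq_zero]
    right; right
    linarith
  rcases (hcos hua).eq_zero_or_eq_zero_of_mul_eq_zero ((hcos hva).mul hH) hprod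
    isPreconnected_univ with h | h
  · exact absurd (h s₁ trivial) hs₁
  rcases (hcos hva).eq_zero_or_eq_zero_of_mul_eq_zero hH h isPreconnected_univ with h | h
  · exact absurd (h s₂ trivial) hs₂
  exact sub_eq_zero.1 (h s trivial)

/-- The relation `κ sin u cos v = cos u sin v` as a bilinear relation between `exp (2iu)` and
`exp (2iv)`. -/
lemma mul_exp_sub_one_mul_exp_add_one {κ u v : ℝ}
    (h : κ * (Real.sin u * Real.cos v) = Real.cos u * Real.sin v) :
    (κ : ℂ) * ((Complex.exp (2 * Complex.I * u) - 1) * (Complex.exp (2 * Complex.I * v) + 1)) =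
      (Complex.exp (2 * Complex.I * u) + 1) * (Complex.exp (2 * Complex.I * v) - 1) := by
  have hC : (κ : ℂ) * (Complex.sin u * Complex.cos v) = Complex.cos u * Complex.sin v := by
    exact_mod_cast h
  have key (w : ℝ) : Complex.exp (2 * Complex.I * w) - 1 =
        2 * Complex.I * Complex.sin w * Complex.exp (w * Complex.I) ∧
      Complex.exp (2 * Complex.I * w) + 1 =
        2 * Complex.cos w * Complex.exp (w * Complex.I) := by
    have h₂ : Complex.exp (2 * Complex.I * w) = Complex.exp (w * Complex.I) ^ 2 := by
      rw [← Complex.exp_nat_mul]; congr 1; push_cast; ring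
    have h₁ := Complex.sin_sq_add_cos_sq (w : ℂ)
    have hI := Complex.I_sq
    rw [h₂, Complex.exp_mul_I]
    constructor
    · linear_combination h₁ - Complex.sin w ^ 2 * hI
    · linear_combination -h₁ + Complex.sin w ^ 2 * hI
  rw [(key u).1, (key u).2, (key v).1, (key v).2]
  linear_combination 4 * Complex.I * Complex.exp (u * Complex.I) * Complex.exp (v * Complex.I) * hC

open Polynomial in
/-- A four-term monic polynomial with as many distinct roots as its degree is the product of the
corresponding linear factors. -/
lemma eq_prod_sub_of_injective_of_roots {N : ℕ} (hN : 2 ≤ N) {r : Fin N → ℂ}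
    (hr : Function.Injective r) (b c d : ℂ)
    (hroot : ∀ j, r j ^ N - b * r j ^ (N - 1) + c * r j - d = 0) (w : ℂ) :
    w ^ N - b * w ^ (N - 1) + c * w - d = ∏ k, (w - r k) := by
  set Q : ℂ[X] := C b * X ^ (N - 1) - C c * X + C d
  have hQ : Q.degree < (N : WithBot ℕ) := by
    have h₁ : (C b * X ^ (N - 1) : ℂ[X]).degree < (N : WithBot ℕ) :=
      (degree_C_mul_X_pow_le _ _).trans_lt (by exact_mod_cast (by omega : N - 1 < N))
    have h₂ : (C c * X : ℂ[X]).degree < (N : WithBot ℕ) :=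
      (degree_C_mul_X_le _).trans_lt (by exact_mod_cast (by omega : 1 < N))
    have h₃ : (C d : ℂ[X]).degree < (N : WithBot ℕ) :=
      degree_C_le.trans_lt (by exact_mod_cast (by omega : 0 < N))
    exact (degree_add_le _ _).trans_lt
      (max_lt ((degree_sub_le _ _).trans_lt (max_lt h₁ h₂)) h₃)
  have hmonic : (X ^ N - Q).Monic := monic_X_pow_sub hQ
  have hdeg : (X ^ N - Q).degree = (N : WithBot ℕ) := by
    rw [degree_sub_eq_left_of_degree_lt (by rwa [degree_X_pow]), degree_X_pow]
  have hP : X ^ N - Q = Lagrange.nodal Finset.univ r := by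
    refine eq_of_degree_le_of_eval_index_eq Finset.univ hr.injOn (by simp [hdeg])
      (by simp [hdeg]) (by rw [hmonic, Lagrange.nodal_monic]) fun j _ => ?_
    rw [Lagrange.eval_nodal_at_node (Finset.mem_univ j), ← hroot j]
    simp only [Q, eval_sub, eval_add, eval_mul, eval_pow, eval_X, eval_C]
    ring
  have := congrArg (eval w) hP
  simp only [Q, Lagrange.eval_nodal, eval_sub, eval_add, eval_mul, eval_pow, eval_X, eval_C] at this
  rw [← this]
  ring

/-- **Periodic waves and polynomial roots.**
With `φ` the periodic wave profile, `x_j(t) = j − φ(j − c t)`,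
`z_j(t) = exp(2 i a x_j(t))`, `ν = (κ−1)/(κ+1)`, `σ(t) = exp(2 i a c t)`:
for every `t`, the values `z_1(t), …, z_N(t)` are pairwise distinct, each is a
root of `P(z) = z^N − ν σ z^{N−1} + ν z − σ`, and `P(z) = ∏_{k=1}^N (z − z_k(t))`. -/
theorem periodic_wave_polynomial_roots (N : ℕ) (hN : 2 ≤ N) (κ : ℝ) (hκ : 1 < κ)
    (φ : ℝ → ℝ) (hφ : IsProfile N κ φ) (c : ℝ) (hc : 0 < c)
    (a : ℝ) (ha : a = π / ((N : ℝ) - 1))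
    (x : ℤ → ℝ → ℝ) (hx : ∀ (j : ℤ) (t : ℝ), x j t = (j : ℝ) - φ ((j : ℝ) - c * t))
    (z : ℤ → ℝ → ℂ)
    (hz : ∀ (j : ℤ) (t : ℝ), z j t = Complex.exp (2 * Complex.I * (a : ℂ) * (x j t : ℂ)))
    (ν : ℝ) (hν : ν = (κ - 1) / (κ + 1))
    (σ : ℝ → ℂ) (hσ : ∀ t : ℝ, σ t = Complex.exp (2 * Complex.I * (a : ℂ) * (c : ℂ) * (t : ℂ))) :
    ∀ t : ℝ,
      (∀ j k : Fin N, j ≠ k → z ((j : ℕ) + 1) t ≠ z ((k : ℕ) + 1) t) ∧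
      (∀ j : Fin N,
        (z ((j : ℕ) + 1) t) ^ N - (ν : ℂ) * σ t * (z ((j : ℕ) + 1) t) ^ (N - 1)
          + (ν : ℂ) * z ((j : ℕ) + 1) t - σ t = 0) ∧
      (∀ w : ℂ, w ^ N - (ν : ℂ) * σ t * w ^ (N - 1) + (ν : ℂ) * w - σ t
        = ∏ k : Fin N, (w - z ((k : ℕ) + 1) t)) := by
  intro t
  obtain ⟨L, rfl⟩ : ∃ L, N = L + 1 := ⟨N - 1, by omega⟩
  have hL : (L : ℝ) ≠ 0 := by
    have : L ≠ 0 := by omega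
    exact_mod_cast this
  have haL : (L : ℂ) * a = π := by
    have : (L : ℝ) * a = π := by rw [ha, Nat.cast_succ, add_sub_cancel_right, mul_div_cancel₀ _ hL]
    exact_mod_cast this
  have hpow (j : ℤ) : z j t ^ L *
      Complex.exp (2 * Complex.I * ((π * φ (j - c * t) : ℝ) : ℂ)) = 1 := by
    rw [hz, hx, ← Complex.exp_nat_mul, ← Complex.exp_add, Complex.exp_eq_one_iff]
    refine ⟨j, ?_⟩
    push_cast
    linear_combination 2 * Complex.I * (j - φ (j - c * t)) * haL
  have hinj : Function.Injective fun j : Fin (L + 1) => z ((j : ℕ) + 1) t := by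
    intro j k h
    by_contra hne
    wlog hjk : j < k generalizing j k
    · exact this h.symm (Ne.symm hne) (lt_of_le_of_ne (not_lt.1 hjk) (Ne.symm hne))
    set s : ℝ := (((j : ℕ) : ℤ) + 1 : ℤ) - c * t with hs
    set s' : ℝ := (((k : ℕ) : ℤ) + 1 : ℤ) - c * t with hs'
    have hjk' : ((j : ℕ) : ℝ) < ((k : ℕ) : ℝ) := by exact_mod_cast hjk
    have hkL : ((k : ℕ) : ℝ) ≤ L := by exact_mod_cast Nat.lt_succ_iff.1 k.2
    have hj₀ : (0 : ℝ) ≤ ((j : ℕ) : ℝ) := by positivity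
    have h₁ : φ s < φ s' := hφ.1 (by rw [hs, hs']; push_cast; linarith)
    have h₂ : φ s' < φ s + 1 := by
      rw [← hφ.2.2.2]
      exact hφ.1 (by rw [hs, hs']; push_cast; linarith)
    have hj := hpow ((j : ℕ) + 1)
    have hk := hpow ((k : ℕ) + 1)
    simp only at h
    rw [← h, ← hj] at hk
    have hk := mul_left_cancel₀ (left_ne_zero_of_mul_eq_one hj) hk
    rw [Complex.exp_eq_exp_iff_exists_int] at hk
    obtain ⟨n, hn⟩ := hk
    have hn' : φ s' = φ s + n := by
      have hpi : (2 * Complex.I * π : ℂ) ≠ 0 := by simp [Real.pi_ne_zero]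
      have : (φ s' : ℂ) = φ s + n := by
        apply mul_left_cancel₀ hpi
        push_cast at hn
        simp only [hs, hs']
        push_cast
        linear_combination hn
      exact_mod_cast this
    have hn₀ : (0 : ℝ) < n := by linarith
    have hn₁ : (n : ℝ) < 1 := by linarith
    norm_cast at hn₀ hn₁
    omega
  have hroot (j : Fin (L + 1)) :
      z ((j : ℕ) + 1) t ^ (L + 1) - (ν : ℂ) * σ t * z ((j : ℕ) + 1) t ^ (L + 1 - 1)
        + (ν : ℂ) * z ((j : ℕ) + 1) t - σ t = 0 := by
    set m : ℤ := (j : ℕ) + 1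
    have hF := hpow m
    have hrel := mul_exp_sub_one_mul_exp_add_one (hφ.sin_mul_cos_eq hN (m - c * t))
    rw [← ha] at hrel
    have hzE : z m t =
        σ t * Complex.exp (2 * Complex.I * ((a * (m - c * t - φ (m - c * t)) : ℝ) : ℂ)) := by
      rw [hz, hσ, hx, ← Complex.exp_add]
      congr 1
      push_cast
      ring
    have hκν : (ν : ℂ) * (κ + 1) = κ - 1 := by
      have : ν * (κ + 1) = κ - 1 := by rw [hν]; field_simp
      exact_mod_cast this
    have hκ₀ : (κ + 1 : ℂ) ≠ 0 := by
      have : κ + 1 ≠ 0 := by linarith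
      exact_mod_cast this
    set E := Complex.exp (2 * Complex.I * ((a * (m - c * t - φ (m - c * t)) : ℝ) : ℂ))
    set F := Complex.exp (2 * Complex.I * ((π * φ (m - c * t) : ℝ) : ℂ))
    have hEF : (ν : ℂ) * E * F + E - F - ν = 0 := by
      apply mul_left_cancel₀ hκ₀
      linear_combination hrel + (E * F - 1) * hκν
    rw [Nat.add_sub_cancel, pow_succ]
    set w := z m t ^ L
    linear_combination (w + ν) * hzE + σ t * w * hEF + (σ t - ν * σ t * E) * hF
  exact ⟨fun j k hjk h => hjk (hinj h), hroot,
    eq_prod_sub_of_injective_of_roots hN hinj _ _ _ hroot⟩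
end

section
/- Let N ≥ 2 be an integer, L = N − 1, a = π/L, and let c > π + a. Set ν = sqrt((c² − (π+a)²)/(c² − (π−a)²)), κ = (1+ν)/(1−ν), μ = sqrt(((c+a)² − π²)/((c−a)² − π²)), and let β ∈ ℝ satisfy e^{2aβ} = μ. Let φ: ℝ → ℝ be the unique strictly increasing real-analytic function satisfying κ·tan(a(s − φ(s))) = tan(π·φ(s)) (where defined) and φ(s+N) = φ(s) + 1, and set x_j(t) = j − φ(j − c t) for j = 1,…,N and y₀(t) = c·t − i·β ∈ ℂ. Then the Bäcklund transform equations hold for all t: i·ẋ_j(t) = Σ_{k=1,k≠j}^N a·cot(a(x_j(t) − x_k(t))) − a·cot(a(x_j(t) − y₀(t))) for each j = 1,…,N, and i·ẏ₀(t) = Σ_{k=1}^N a·cot(a(y₀(t) − x_k(t))). -/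
open Real Filter Topology Finset

theorem wave_parameter_relations {a c ν μ : ℝ} (ha : 0 < a) (haπ : a ≤ π) (hc : c > π + a)
    (hν : ν = Real.sqrt ((c ^ 2 - (π + a) ^ 2) / (c ^ 2 - (π - a) ^ 2)))
    (hμ : μ = Real.sqrt (((c + a) ^ 2 - π ^ 2) / ((c - a) ^ 2 - π ^ 2))) :
    0 ≤ ν ∧ ν < 1 ∧ 1 < μ ∧ μ * (c - π - a) = ν * (c - π + a) ∧
      ν * μ * (c + π - a) = c + π + a := by
  have hπ := Real.pi_pos
  have hp : 0 < c - π - a := by linarith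
  have hq : 0 < c + π + a := by linarith
  have hr : 0 < c - π + a := by linarith
  have hs : 0 < c + π - a := by linarith
  have hν2 : ν ^ 2 = (c - π - a) * (c + π + a) / ((c - π + a) * (c + π - a)) := by
    rw [hν, Real.sq_sqrt]
    · congr 1 <;> ring
    · apply div_nonneg <;> nlinarith [mul_pos hp hq, mul_pos hr hs]
  have hμ2 : μ ^ 2 = (c - π + a) * (c + π + a) / ((c - π - a) * (c + π - a)) := by
    rw [hμ, Real.sq_sqrt]
    · congr 1 <;> ring
    · apply div_nonneg <;> nlinarith [mul_pos hr hq, mul_pos hp hs]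
  have hν0 : 0 ≤ ν := hν ▸ Real.sqrt_nonneg _
  have hμ0 : 0 ≤ μ := hμ ▸ Real.sqrt_nonneg _
  refine ⟨hν0, ?_, ?_, ?_, ?_⟩
  · refine (sq_lt_one_iff₀ hν0).1 ?_
    rw [hν2, div_lt_one (by positivity)]
    nlinarith
  · refine (one_lt_sq_iff₀ hμ0).1 ?_
    rw [hμ2, one_lt_div (by positivity)]
    nlinarith
  · refine (sq_eq_sq₀ (by positivity) (by positivity)).1 ?_
    rw [mul_pow, mul_pow, hν2, hμ2]
    field_simp
  · refine (sq_eq_sq₀ (by positivity) (by positivity)).1 ?_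
    rw [mul_pow, mul_pow, hν2, hμ2]
    field_simp

theorem eq_of_cos_comp_eq_zero {g : ℝ → ℝ} (hg : Differentiable ℝ g)
    (h : ∀ s, Real.cos (g s) = 0) (s t : ℝ) : g s = g t := by
  refine is_const_of_deriv_eq_zero hg (fun s => ?_) s t
  have h1 : HasDerivAt (fun s => Real.cos (g s)) (-Real.sin (g s) * deriv g s) s :=
    (hg s).hasDerivAt.cos
  have h2 : (fun s => Real.cos (g s)) = fun _ => 0 := funext h
  rw [h2] at h1
  have h3 := h1.unique (hasDerivAt_const s 0)
  have h4 := Real.sin_sq_add_cos_sq (g s)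
  rw [h s] at h4
  rcases mul_eq_zero.1 h3 with h5 | h5
  · rw [neg_eq_zero.1 h5] at h4
    norm_num at h4
  · exact h5

/-- The implicit equation with denominators cleared; by analyticity it also holds where one of the
tangents is undefined. -/
theorem sin_mul_cos_eq_of_tan_eq {a b κ : ℝ} {T : ℝ} (ha : a ≠ 0) (hb : b ≠ 0) (hT : T ≠ 1)
    {φ : ℝ → ℝ} (hφ : AnalyticOnNhd ℝ φ Set.univ) (hper : ∀ s, φ (s + T) = φ s + 1)
    (h : ∀ s, Real.cos (a * (s - φ s)) ≠ 0 → Real.cos (b * φ s) ≠ 0 →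
      κ * Real.tan (a * (s - φ s)) = Real.tan (b * φ s)) (s : ℝ) :
    κ * Real.sin (a * (s - φ s)) * Real.cos (b * φ s)
      = Real.sin (b * φ s) * Real.cos (a * (s - φ s)) := by
  have hθ : AnalyticOnNhd ℝ (fun s => a * (s - φ s)) Set.univ :=
    analyticOnNhd_const.mul (analyticOnNhd_id.sub hφ)
  have hψ : AnalyticOnNhd ℝ (fun s => b * φ s) Set.univ := analyticOnNhd_const.mul hφ
  have hcosθ : AnalyticOnNhd ℝ (fun s => Real.cos (a * (s - φ s))) Set.univ :=
    fun s hs => Real.analyticAt_cos.fun_comp (hθ s hs)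
  have hsinθ : AnalyticOnNhd ℝ (fun s => Real.sin (a * (s - φ s))) Set.univ :=
    fun s hs => Real.analyticAt_sin.fun_comp (hθ s hs)
  have hcosψ : AnalyticOnNhd ℝ (fun s => Real.cos (b * φ s)) Set.univ :=
    fun s hs => Real.analyticAt_cos.fun_comp (hψ s hs)
  have hsinψ : AnalyticOnNhd ℝ (fun s => Real.sin (b * φ s)) Set.univ :=
    fun s hs => Real.analyticAt_sin.fun_comp (hψ s hs)
  have hmain : AnalyticOnNhd ℝ (fun s => κ * Real.sin (a * (s - φ s)) * Real.cos (b * φ s)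
      - Real.sin (b * φ s) * Real.cos (a * (s - φ s))) Set.univ :=
    ((analyticOnNhd_const.mul hsinθ).mul hcosψ).sub (hsinψ.mul hcosθ)
  have hprod : ∀ s ∈ Set.univ, (Real.cos (a * (s - φ s)) * Real.cos (b * φ s)) *
      (κ * Real.sin (a * (s - φ s)) * Real.cos (b * φ s)
        - Real.sin (b * φ s) * Real.cos (a * (s - φ s))) = 0 := by
    intro s _
    by_cases h1 : Real.cos (a * (s - φ s)) = 0
    · simp [h1]
    by_cases h2 : Real.cos (b * φ s) = 0
    · simp [h2]
    have h3 := h s h1 h2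
    rw [Real.tan_eq_sin_div_cos, Real.tan_eq_sin_div_cos] at h3
    rw [mul_div_assoc', div_eq_div_iff h1 h2] at h3
    rw [mul_eq_zero]
    right
    linarith
  rcases (hcosθ.mul hcosψ).eq_zero_or_eq_zero_of_mul_eq_zero hmain hprod
    isPreconnected_univ with h0 | h0
  · exfalso
    rcases hcosθ.eq_zero_or_eq_zero_of_mul_eq_zero hcosψ h0 isPreconnected_univ with h1 | h1
    · have := eq_of_cos_comp_eq_zero (fun s => (hθ s trivial).differentiableAt)
        (fun s => h1 s trivial) (0 + T) 0
      have := mul_left_cancel₀ ha this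
      rw [hper] at this
      exact hT (by linarith)
    · have := eq_of_cos_comp_eq_zero (fun s => (hψ s trivial).differentiableAt)
        (fun s => h1 s trivial) (0 + T) 0
      have := mul_left_cancel₀ hb this
      rw [hper] at this
      linarith
  · exact sub_eq_zero.1 (h0 s trivial)

theorem two_I_mul_exp_pow_mul_sin_sub_sin (a δ ν z : ℂ) (m : ℕ) :
    2 * Complex.I * Complex.exp (Complex.I * (a * z)) ^ (m + 2) *
      (Complex.sin ((m + 2) * a * z - δ) - ν * Complex.sin (m * a * z + δ)) =
      Complex.exp (-(Complex.I * δ)) * (Complex.exp (Complex.I * (a * z)) ^ 2) ^ (m + 2)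
        - Complex.exp (Complex.I * δ)
        - ν * (Complex.exp (Complex.I * δ) * (Complex.exp (Complex.I * (a * z)) ^ 2) ^ (m + 1)
          - Complex.exp (-(Complex.I * δ)) * Complex.exp (Complex.I * (a * z)) ^ 2) := by
  have h1 : Complex.exp (((m + 2) * a * z - δ) * Complex.I) =
      Complex.exp (Complex.I * (a * z)) ^ (m + 2) * Complex.exp (-(Complex.I * δ)) := by
    rw [← Complex.exp_nat_mul, ← Complex.exp_add]
    congr 1
    push_cast
    ring
  have h2 : Complex.exp ((m * a * z + δ) * Complex.I) =
      Complex.exp (Complex.I * (a * z)) ^ m * Complex.exp (Complex.I * δ) := by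
    rw [← Complex.exp_nat_mul, ← Complex.exp_add]
    congr 1
    ring
  have he := Complex.exp_ne_zero (Complex.I * (a * z))
  have hq := Complex.exp_ne_zero (Complex.I * δ)
  rw [Complex.sin, Complex.sin, neg_mul, neg_mul, Complex.exp_neg, Complex.exp_neg, h1, h2,
    Complex.exp_neg]
  generalize Complex.exp (Complex.I * (a * z)) = e at *
  generalize Complex.exp (Complex.I * δ) = q at *
  field_simp
  rw [Complex.I_sq]
  ring

theorem exp_sq_sub_exp_sq (a x z : ℂ) :
    Complex.exp (Complex.I * (a * z)) ^ 2 - Complex.exp (Complex.I * (a * x)) ^ 2 =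
      Complex.exp (Complex.I * (a * z)) *
        (2 * Complex.I * Complex.exp (Complex.I * (a * x)) * Complex.sin (a * (z - x))) := by
  have h1 : Complex.exp ((a * (z - x)) * Complex.I) =
      Complex.exp (Complex.I * (a * z)) * (Complex.exp (Complex.I * (a * x)))⁻¹ := by
    rw [← Complex.exp_neg, ← Complex.exp_add]
    congr 1
    ring
  have he := Complex.exp_ne_zero (Complex.I * (a * z))
  have hq := Complex.exp_ne_zero (Complex.I * (a * x))
  rw [Complex.sin, neg_mul, Complex.exp_neg, h1]
  field_simp
  rw [Complex.I_sq]
  ring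

/-- A trigonometric polynomial of degree `m + 2` with `m + 2` distinct roots is a product of sines. -/
theorem exists_eq_prod_sin {ι : Type*} {s : Finset ι} {m : ℕ} (hs : #s = m + 2)
    (a δ ν : ℂ) (x : ι → ℂ)
    (hx : ∀ i ∈ s, ∀ j ∈ s, i ≠ j → Complex.sin (a * (x i - x j)) ≠ 0)
    (hroot : ∀ i ∈ s, Complex.sin ((m + 2) * a * x i - δ) - ν * Complex.sin (m * a * x i + δ) = 0) :
    ∃ K ≠ 0, ∀ z, Complex.sin ((m + 2) * a * z - δ) - ν * Complex.sin (m * a * z + δ) =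
      K * ∏ i ∈ s, Complex.sin (a * (z - x i)) := by
  classical
  set q := Complex.exp (Complex.I * δ) with hq
  set q' := Complex.exp (-(Complex.I * δ)) with hq'
  set u : ι → ℂ := fun i => Complex.exp (Complex.I * (a * x i)) ^ 2 with hu
  have hinj : Set.InjOn u s := by
    intro i hi j hj hij
    by_contra hne
    have h := exp_sq_sub_exp_sq a (x j) (x i)
    rw [sub_eq_zero.2 hij] at h
    have := hx i hi j hj hne
    have := Complex.exp_ne_zero (Complex.I * (a * x i))
    have := Complex.exp_ne_zero (Complex.I * (a * x j))
    simp_all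
  open Polynomial in
  have hpoly : (C q' * X ^ (m + 2) - C q - C ν * (C q * X ^ (m + 1) - C q' * X) : ℂ[X]) =
      C q' * Lagrange.nodal s u := by
    refine eq_of_degree_sub_lt_of_eval_index_eq s hinj ?_ ?_
    · have h1 : (C q' * X ^ (m + 2) - C q - C ν * (C q * X ^ (m + 1) - C q' * X)
          - C q' * Lagrange.nodal s u : ℂ[X]) = C q' * (X ^ (m + 2) - Lagrange.nodal s u)
            - (C q + C ν * (C q * X ^ (m + 1) - C q' * X)) := by ring
      rw [h1, hs]
      refine (degree_sub_le _ _).trans_lt (max_lt ?_ ?_)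
      · rw [degree_C_mul (Complex.exp_ne_zero _)]
        refine (degree_sub_lt_left ?_ (pow_ne_zero _ X_ne_zero) ?_).trans_eq (degree_X_pow _)
        · rw [degree_X_pow, Lagrange.degree_nodal, hs]
        · rw [leadingCoeff_X_pow, Lagrange.nodal_monic.leadingCoeff]
      · refine lt_of_le_of_lt (b := ((m + 1 : ℕ) : WithBot ℕ)) ?_ (by exact_mod_cast Nat.lt_succ_self _)
        compute_degree
        exact max_le (by push_cast; exact le_rfl) (by exact_mod_cast Nat.le_add_left 1 m)
    · intro i hi
      have h := two_I_mul_exp_pow_mul_sin_sub_sin a δ ν (x i) m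
      rw [hroot i hi, mul_zero] at h
      simp only [eval_sub, eval_mul, eval_C, eval_pow, eval_X, Lagrange.eval_nodal_at_node hi,
        mul_zero]
      exact h.symm
  refine ⟨q' * (∏ i ∈ s, 2 * Complex.I * Complex.exp (Complex.I * (a * x i))) / (2 * Complex.I),
    ?_, fun z => ?_⟩
  · refine div_ne_zero (mul_ne_zero (Complex.exp_ne_zero _) (Finset.prod_ne_zero_iff.2 ?_)) ?_
    · intro i _
      simp
    · simp
  · have h := congrArg (Polynomial.eval (Complex.exp (Complex.I * (a * z)) ^ 2)) hpoly
    simp only [Polynomial.eval_sub, Polynomial.eval_mul, Polynomial.eval_C, Polynomial.eval_pow,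
      Polynomial.eval_X, Lagrange.eval_nodal] at h
    rw [← two_I_mul_exp_pow_mul_sin_sub_sin a δ ν z m, Finset.prod_congr rfl fun i _ => exp_sq_sub_exp_sq a (x i) z,
      Finset.prod_mul_distrib, Finset.prod_const, hs, Finset.prod_mul_distrib] at h
    have he := Complex.exp_ne_zero (Complex.I * (a * z))
    have hI : 2 * Complex.I ≠ 0 := by simp
    refine mul_left_cancel₀ (mul_ne_zero hI (pow_ne_zero (m + 2) he)) ?_
    rw [h, mul_assoc (2 * Complex.I), div_mul_eq_mul_div, mul_div_assoc', mul_div_cancel₀ _ hI]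
    ring

theorem hasDerivAt_mul_prod_sin {ι : Type*} {s : Finset ι} (K a : ℂ) (x : ι → ℂ) {z : ℂ}
    (hz : ∀ i ∈ s, Complex.sin (a * (z - x i)) ≠ 0) :
    HasDerivAt (fun z => K * ∏ i ∈ s, Complex.sin (a * (z - x i)))
      ((∑ i ∈ s, a * Complex.cot (a * (z - x i))) * (K * ∏ i ∈ s, Complex.sin (a * (z - x i)))) z := by
  classical
  have h1 : ∀ i ∈ s, HasDerivAt (fun z => Complex.sin (a * (z - x i)))
      (Complex.cos (a * (z - x i)) * (a * 1)) z := fun i _ =>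
    (((hasDerivAt_id' z).sub_const (x i)).const_mul a).csin
  refine ((HasDerivAt.fun_finsetProd h1).const_mul K).congr_deriv ?_
  rw [Finset.sum_mul, Finset.mul_sum]
  refine Finset.sum_congr rfl fun i hi => ?_
  rw [← Finset.mul_prod_erase s _ hi, Complex.cot_eq_cos_div_sin, smul_eq_mul]
  have := hz i hi
  field_simp

/-- At a root `x j` of `f = K ∏ sin (a (z - x i))`, the ratio `f'' / f'` is twice a sum of
cotangents over the other roots. -/
theorem second_deriv_eq_sum_cot_at_root {ι : Type*} [DecidableEq ι] {s : Finset ι} {K a : ℂ} {x : ι → ℂ}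
    (hK : K ≠ 0) (ha : a ≠ 0)
    (hx : ∀ i ∈ s, ∀ j ∈ s, i ≠ j → Complex.sin (a * (x i - x j)) ≠ 0)
    {f f' : ℂ → ℂ} {f'' : ℂ} (hf : ∀ z, f z = K * ∏ i ∈ s, Complex.sin (a * (z - x i)))
    (hf' : ∀ z, HasDerivAt f (f' z) z) {j : ι} (hj : j ∈ s) (hf'' : HasDerivAt f' f'' (x j)) :
    f' (x j) ≠ 0 ∧
      f'' = 2 * (∑ k ∈ s.erase j, a * Complex.cot (a * (x j - x k))) * f' (x j) := by
  set G : ℂ → ℂ := fun z => K * ∏ i ∈ s.erase j, Complex.sin (a * (z - x i)) with hG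
  have hne : ∀ i ∈ s.erase j, Complex.sin (a * (x j - x i)) ≠ 0 := fun i hi =>
    hx j hj i (Finset.mem_of_mem_erase hi) (Finset.ne_of_mem_erase hi).symm
  have hGd : Differentiable ℂ G := by fun_prop
  have hGd' : DifferentiableAt ℂ (deriv G) (x j) := (hGd.analyticAt (x j)).deriv.differentiableAt
  have hG0 : G (x j) ≠ 0 := mul_ne_zero hK (Finset.prod_ne_zero_iff.2 hne)
  have hfG : f = fun z => Complex.sin (a * (z - x j)) * G z := by
    funext z
    rw [hf, ← Finset.mul_prod_erase s _ hj]
    simp only [hG]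
    ring
  have hlin : ∀ z, HasDerivAt (fun z => a * (z - x j)) (a * 1) z := fun z =>
    ((hasDerivAt_id' z).sub_const (x j)).const_mul a
  have hfd : f' = fun z => Complex.cos (a * (z - x j)) * (a * 1) * G z +
      Complex.sin (a * (z - x j)) * deriv G z := by
    funext z
    have h := (hlin z).csin.mul (hGd z).hasDerivAt
    have h2 := hf' z
    rw [hfG] at h2
    exact h2.unique h
  have hfdd := (((hlin (x j)).ccos.mul_const (a * 1)).mul (hGd (x j)).hasDerivAt).add
    ((hlin (x j)).csin.mul hGd'.hasDerivAt)
  have h2 := (hfd ▸ hf'').unique hfdd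
  have hS := (hasDerivAt_mul_prod_sin K a x hne).deriv
  have hS' : deriv G (x j) =
    (∑ k ∈ s.erase j, a * Complex.cot (a * (x j - x k))) * G (x j) := hS
  have hf'x : f' (x j) = a * G (x j) := by
    simp [hfd]
  refine ⟨hf'x ▸ mul_ne_zero ha hG0, ?_⟩
  rw [h2, hf'x, hS']
  simp
  ring

theorem velocity_of_exp_relations {p a c ν μ E E' F F' v S D D' : ℂ} (hD : D ≠ 0)
    (hE : E * E' = 1) (hF : F * F' = 1) (hne : μ * F - E ≠ 0)
    (hroot : E - E' = ν * (F - F'))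
    (h1 : μ * (c - p - a) = ν * (c - p + a)) (h2 : ν * μ * (c + p - a) = c + p + a)
    (hDeq : 2 * D = (p + a) * (E + E') - ν * (p - a) * (F + F'))
    (hv : 2 * (v * D) = a * c * ((E + E') + ν * (F + F')))
    (hD' : D' = 2 * p * a * Complex.I * (E - E')) (hS : D' = 2 * S * D) :
    Complex.I * v = S - a * ((E + μ * F) / (Complex.I * (μ * F - E))) := by
  have key : (2 * p * (E - E') - c * ((E + E') + ν * (F + F'))) * (E - μ * F) =
      2 * D * (E + μ * F) := by
    rw [hDeq]
    linear_combination ((p - a - c) * E - μ * (c + p - a) * F) * hroot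
      + 2 * ν * μ * (c + p - a) * hF - 2 * (p + a + c) * hE + 2 * h2 + 2 * E * F * h1
  have hI := Complex.I_ne_zero
  have h3 : (E + μ * F) / (Complex.I * (μ * F - E)) =
      -Complex.I * ((E + μ * F) / (μ * F - E)) := by
    rw [div_mul_eq_div_div_swap, div_eq_mul_inv _ Complex.I, Complex.inv_I]
    ring
  rw [h3]
  refine mul_left_cancel₀ (mul_ne_zero hD hne) ?_
  have h4 : (E + μ * F) / (μ * F - E) * (μ * F - E) = E + μ * F := div_mul_cancel₀ _ hne
  linear_combination (Complex.I * (μ * F - E) / 2) * hv + ((μ * F - E) / 2) * hS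
    - ((μ * F - E) / 2) * hD' - a * Complex.I * D * h4 + (a * Complex.I / 2) * key

theorem sin_add_eq_mul_sin_sub {κ ν θ p : ℝ} (hκ : κ = (1 + ν) / (1 - ν)) (hν : ν < 1)
    (h : κ * Real.sin θ * Real.cos p + Real.sin p * Real.cos θ = 0) :
    Real.sin (p + θ) = ν * Real.sin (p - θ) := by
  have h1 : 1 - ν ≠ 0 := by linarith
  rw [hκ] at h
  field_simp at h
  rw [Real.sin_add, Real.sin_sub]
  linear_combination h

/-- The positions `j - φ (j - τ)` are roots of a trigonometric polynomial. -/
theorem IsProfile.sin_eq {m : ℕ} {κ ν a : ℝ} {φ : ℝ → ℝ} (hφ : IsProfile (m + 2) κ φ)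
    (ha : a * (m + 1) = π) (hκ : κ = (1 + ν) / (1 - ν)) (hν : ν < 1) (j : ℤ) (τ : ℝ) :
    Real.sin ((m + 2) * a * (j - φ (j - τ)) - a * τ) =
      ν * Real.sin (m * a * (j - φ (j - τ)) + a * τ) := by
  obtain ⟨-, han, hrel, hper⟩ := hφ
  have hm : (m : ℝ) + 1 ≠ 0 := by positivity
  have hπ := Real.pi_ne_zero
  have ha' : π / (((m + 2 : ℕ) : ℝ) - 1) = a := by
    rw [div_eq_iff (by push_cast; convert hm using 1; ring), ← ha]
    push_cast
    ring
  have ha0 : a ≠ 0 := by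
    rintro rfl
    exact hπ (by rw [← ha, zero_mul])
  rw [ha'] at hrel
  have hT : ((m + 2 : ℕ) : ℝ) ≠ 1 := by
    exact_mod_cast (by omega : m + 2 ≠ 1)
  have h := sin_mul_cos_eq_of_tan_eq ha0 hπ hT han hper hrel (j - τ)
  set y : ℝ := j - φ (j - τ) with hy
  have h1 : φ (j - τ) = j - y := by rw [hy]; ring
  rw [h1, show π * (j - y) = j * π - π * y by ring, Real.cos_int_mul_pi_sub,
    Real.sin_int_mul_pi_sub] at h
  have h2 : ((-1 : ℝ)) ^ j ≠ 0 := zpow_ne_zero _ (by norm_num)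
  have h3 := sin_add_eq_mul_sin_sub (θ := a * (j - τ - (j - y))) (p := π * y) hκ hν
    (mul_left_cancel₀ h2 (by linear_combination h))
  rw [← ha] at h3
  convert h3 using 2
  · ring
  · congr 1
    ring

theorem IsProfile.sin_sub_ne_zero {m : ℕ} {κ a : ℝ} {φ : ℝ → ℝ} (hφ : IsProfile (m + 2) κ φ)
    (ha : a * (m + 1) = π) (τ : ℝ) {j k : ℤ} (hj : j ∈ Finset.Icc (1 : ℤ) ((m + 2 : ℕ) : ℤ))
    (hk : k ∈ Finset.Icc (1 : ℤ) ((m + 2 : ℕ) : ℤ)) (hjk : j ≠ k) :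
    Real.sin (a * ((j - φ (j - τ)) - (k - φ (k - τ)))) ≠ 0 := by
  obtain ⟨hmono, -, -, hper⟩ := hφ
  have hperZ : ∀ (n : ℤ) (s : ℝ), φ (s + n * ((m + 2 : ℕ) : ℝ)) = φ s + n := by
    intro n
    induction n with
    | zero => simp
    | succ i ih =>
      intro s
      have := hper (s + i * ((m + 2 : ℕ) : ℝ))
      have h2 := ih s
      push_cast at *
      rw [show s + (i + 1) * ((m : ℝ) + 2) = s + i * (m + 2) + (m + 2) by ring, this, h2]
      ring
    | pred i ih =>
      intro s
      have := hper (s + (-(i : ℤ) - 1 : ℤ) * ((m + 2 : ℕ) : ℝ))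
      have h2 := ih s
      push_cast at *
      rw [show s + (-i - 1) * ((m : ℝ) + 2) + (m + 2) = s + -i * (m + 2) by ring, h2] at this
      linarith
  intro h
  obtain ⟨n, hn⟩ := Real.sin_eq_zero_iff.1 h
  have ha0 : a ≠ 0 := by
    rintro rfl
    exact Real.pi_ne_zero (by rw [← ha, zero_mul])
  have h1 : (n : ℝ) * (m + 1) = (j - φ (j - τ)) - (k - φ (k - τ)) := by
    refine mul_left_cancel₀ ha0 ?_
    rw [← hn, ← ha]
    ring
  have h2 := hperZ (j - k - n * (m + 1)) (k - τ)
  push_cast at h2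
  rw [show φ (k - τ) + ((j : ℝ) - k - n * (m + 1)) = φ (j - τ) by rw [h1]; ring] at h2
  have h3 := hmono.injective h2
  have h4 : k + (j - k - n * (m + 1)) * (m + 2) = j := by
    have h5 : ((k : ℝ) + (j - k - n * (m + 1)) * (m + 2)) = j := by linarith
    exact_mod_cast h5
  rw [Finset.mem_Icc] at hj hk
  push_cast at hj hk
  set r : ℤ := j - k - n * (m + 1)
  have h6 : r = 0 := by
    by_contra hr
    rcases lt_or_gt_of_ne hr with hr | hr <;> nlinarith
  rw [h6] at h4
  exact hjk (by linarith)

/-- **Validity of the Bäcklund transform equations for the periodic wave.**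
Let `N ≥ 2`, `L = N − 1`, `a = π/L`, `c > π + a`, with `ν, κ, μ, β` as specified,
`φ` the periodic wave profile, `x_j(t) = j − φ(j − c t)` and `y₀(t) = c t − i β`.
Then `i ẋ_j = Σ_{k≠j} a cot(a(x_j − x_k)) − a cot(a(x_j − y₀))` for `j = 1,…,N`,
and `i ẏ₀ = Σ_k a cot(a(y₀ − x_k))`. -/
theorem backlund_equations (N : ℕ) (hN : 2 ≤ N)
    (a : ℝ) (ha : a = π / ((N : ℝ) - 1)) (c : ℝ) (hc : c > π + a)
    (ν : ℝ) (hν : ν = Real.sqrt ((c ^ 2 - (π + a) ^ 2) / (c ^ 2 - (π - a) ^ 2)))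
    (κ : ℝ) (hκ : κ = (1 + ν) / (1 - ν))
    (μ : ℝ) (hμ : μ = Real.sqrt (((c + a) ^ 2 - π ^ 2) / ((c - a) ^ 2 - π ^ 2)))
    (β : ℝ) (hβ : Real.exp (2 * a * β) = μ)
    (φ : ℝ → ℝ) (hφ : IsProfile N κ φ)
    (x : ℤ → ℝ → ℝ) (hx : ∀ (j : ℤ) (t : ℝ), x j t = (j : ℝ) - φ ((j : ℝ) - c * t))
    (y₀ : ℝ → ℂ) (hy₀ : ∀ t : ℝ, y₀ t = (c : ℂ) * (t : ℂ) - Complex.I * (β : ℂ)) :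
    ∀ t : ℝ,
      (∀ j : ℤ, j ∈ Finset.Icc (1 : ℤ) (N : ℤ) →
        Complex.I * ((deriv (fun t' : ℝ => x j t') t : ℝ) : ℂ)
          = (∑ k ∈ (Finset.Icc (1 : ℤ) (N : ℤ)).erase j,
              (a : ℂ) * Complex.cot ((a : ℂ) * ((x j t : ℝ) - (x k t : ℝ))))
            - (a : ℂ) * Complex.cot ((a : ℂ) * (((x j t : ℝ) : ℂ) - y₀ t))) ∧
      Complex.I * deriv y₀ t
        = ∑ k ∈ Finset.Icc (1 : ℤ) (N : ℤ),
            (a : ℂ) * Complex.cot ((a : ℂ) * (y₀ t - ((x k t : ℝ) : ℂ))) := by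
  obtain ⟨m, rfl⟩ := Nat.exists_eq_add_of_le' hN
  have hm : (0 : ℝ) < (m : ℝ) + 1 := by positivity
  have haπ : a * (m + 1) = π := by
    rw [ha]
    push_cast
    rw [show (m : ℝ) + 2 - 1 = m + 1 by ring]
    field_simp
  have ha0 : 0 < a := by
    refine pos_of_mul_pos_left (b := (m : ℝ) + 1) ?_ hm.le
    rw [haπ]
    exact Real.pi_pos
  have haleπ : a ≤ π := by
    rw [← haπ]
    have : (0 : ℝ) ≤ m := by positivity
    nlinarith
  obtain ⟨-, hν1, hμ1, hR1, hR2⟩ := wave_parameter_relations ha0 haleπ hc hν hμ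
  have hμ0 : 0 < μ := by linarith
  have hβ0 : β ≠ 0 := by
    rintro rfl
    rw [mul_zero, Real.exp_zero] at hβ
    linarith
  have hroot : ∀ (j : ℤ) (t : ℝ), Real.sin ((m + 2) * a * x j t - a * (c * t)) =
      ν * Real.sin (m * a * x j t + a * (c * t)) := fun j t => by
    rw [hx]
    exact hφ.sin_eq haπ hκ hν1 j (c * t)
  have hcard : #(Finset.Icc (1 : ℤ) ((m + 2 : ℕ) : ℤ)) = m + 2 := by
    rw [Int.card_Icc]
    omega
  have haπC : (a : ℂ) * (m + 1) = π := by exact_mod_cast haπ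
  have hR1C : (μ : ℂ) * (c - π - a) = ν * (c - π + a) := by exact_mod_cast hR1
  have hR2C : (ν : ℂ) * μ * (c + π - a) = c + π + a := by exact_mod_cast hR2
  have haC : (a : ℂ) ≠ 0 := by exact_mod_cast ha0.ne'
  have hμC : (μ : ℂ) ≠ 0 := by exact_mod_cast hμ0.ne'
  have hexpβ : Complex.exp (2 * a * β) = μ := by
    rw [← hβ]
    push_cast
    rfl
  intro t
  set δ : ℂ := a * (c * t) with hδ
  set s := Finset.Icc (1 : ℤ) ((m + 2 : ℕ) : ℤ) with hs
  have hsep : ∀ i ∈ s, ∀ j ∈ s, i ≠ j →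
      Complex.sin (a * ((x i t : ℂ) - (x j t : ℂ))) ≠ 0 := by
    intro i hi j hj hij
    have := hφ.sin_sub_ne_zero haπ (c * t) hi hj hij
    rw [← hx, ← hx] at this
    exact_mod_cast this
  have hrootC : ∀ i ∈ s, Complex.sin ((m + 2) * a * (x i t : ℂ) - δ)
      - ν * Complex.sin (m * a * (x i t : ℂ) + δ) = 0 := by
    intro i _
    have h := congrArg (fun r : ℝ => (r : ℂ)) (hroot i t)
    push_cast at h
    exact sub_eq_zero.2 h
  obtain ⟨K, hK, hfac⟩ := exists_eq_prod_sin hcard a δ ν (fun i => (x i t : ℂ)) hsep hrootC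
  set f : ℂ → ℂ := fun z => Complex.sin ((m + 2) * a * z - δ) - ν * Complex.sin (m * a * z + δ)
    with hf
  replace hfac : ∀ z, f z = K * ∏ i ∈ s, Complex.sin (a * (z - (x i t : ℂ))) := hfac
  set f' : ℂ → ℂ := fun z => Complex.cos ((m + 2) * a * z - δ) * ((m + 2) * a * 1)
    - ν * (Complex.cos (m * a * z + δ) * (m * a * 1)) with hf'
  have hlin1 : ∀ z, HasDerivAt (fun z : ℂ => (m + 2) * a * z - δ) ((m + 2) * a * 1) z :=
    fun z => ((hasDerivAt_id' z).const_mul _).sub_const δ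
  have hlin2 : ∀ z, HasDerivAt (fun z : ℂ => m * a * z + δ) (m * a * 1) z :=
    fun z => ((hasDerivAt_id' z).const_mul _).add_const δ
  have hfd : ∀ z, HasDerivAt f (f' z) z := fun z =>
    (hlin1 z).csin.sub ((hlin2 z).csin.const_mul (ν : ℂ))
  have hfd' : ∀ z, HasDerivAt f' _ z := fun z =>
    ((hlin1 z).ccos.mul_const _).sub (((hlin2 z).ccos.mul_const _).const_mul (ν : ℂ))
  refine ⟨fun j hj => ?_, ?_⟩
  · obtain ⟨hD, hS⟩ := second_deriv_eq_sum_cot_at_root hK haC hsep hfac hfd hj (hfd' (x j t))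
    have hxd : HasDerivAt (fun t' => x j t') (deriv (fun t' => x j t') t) t := by
      have : DifferentiableAt ℝ φ (j - c * t) := (hφ.2.1 _ trivial).differentiableAt
      have h2 : (fun t' => x j t') = fun t' => (j : ℝ) - φ (j - c * t') := funext (hx j)
      rw [h2]
      refine DifferentiableAt.hasDerivAt ?_
      fun_prop
    set v := deriv (fun t' => x j t') t
    have hτ : HasDerivAt (fun t' : ℝ => a * (c * t')) (a * (c * 1)) t :=
      ((hasDerivAt_id' t).const_mul c).const_mul a
    have hleft := ((hxd.const_mul ((m + 2) * a)).sub hτ).sin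
    have hright := (((hxd.const_mul (m * a)).add hτ).sin).const_mul ν
    have hvel := hleft.unique (hright.congr_of_eventuallyEq (.of_forall fun t' => hroot j t'))
    have hvelC := congrArg (fun r : ℝ => (r : ℂ)) hvel
    simp only [Pi.sub_apply, Pi.add_apply] at hvelC
    push_cast at hvelC
    set X : ℂ := (x j t : ℂ) with hX
    have hEE : Complex.exp (((m + 2) * a * X - δ) * Complex.I) *
        Complex.exp (-((m + 2) * a * X - δ) * Complex.I) = 1 := by
      rw [← Complex.exp_add, neg_mul, add_neg_cancel, Complex.exp_zero]
    have hFF : Complex.exp ((m * a * X + δ) * Complex.I) *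
        Complex.exp (-(m * a * X + δ) * Complex.I) = 1 := by
      rw [← Complex.exp_add, neg_mul, add_neg_cancel, Complex.exp_zero]
    have hnE : ‖Complex.exp (((m + 2) * a * X - δ) * Complex.I)‖ = 1 := by
      have := Complex.norm_exp_ofReal_mul_I ((m + 2) * a * x j t - a * (c * t))
      push_cast at this
      exact this
    have hnF : ‖Complex.exp ((m * a * X + δ) * Complex.I)‖ = 1 := by
      have := Complex.norm_exp_ofReal_mul_I (m * a * x j t + a * (c * t))
      push_cast at this
      exact this
    have hratio : Complex.exp (2 * Complex.I * (a * (X - y₀ t))) * (μ *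
        Complex.exp ((m * a * X + δ) * Complex.I)) =
          Complex.exp (((m + 2) * a * X - δ) * Complex.I) := by
      rw [← hexpβ, ← Complex.exp_add, ← Complex.exp_add, hy₀]
      congr 1
      linear_combination (2 * a * β) * Complex.I_sq
    have hrj := hrootC j hj
    simp only [Complex.sin, Complex.cos] at hrj hvelC hS hf'
    rw [Complex.cot_eq_exp_ratio]
    have hD2 : f' X = _ := congrFun hf' X
    have hne : (μ : ℂ) * Complex.exp ((m * a * X + δ) * Complex.I) -
        Complex.exp (((m + 2) * a * X - δ) * Complex.I) ≠ 0 := by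
      intro h
      have := congrArg norm (sub_eq_zero.1 h)
      rw [norm_mul, hnE, hnF, Complex.norm_of_nonneg hμ0.le] at this
      linarith
    rw [← hX] at *
    clear_value f' X
    generalize Complex.exp (((m + 2) * a * X - δ) * Complex.I) = E at *
    generalize Complex.exp (-((m + 2) * a * X - δ) * Complex.I) = E' at *
    generalize Complex.exp ((m * a * X + δ) * Complex.I) = F at *
    generalize Complex.exp (-(m * a * X + δ) * Complex.I) = F' at *
    have hmaC : (m : ℂ) * a = π - a := by linear_combination haπC
    have hmaC2 : ((m : ℂ) + 2) * a = π + a := by linear_combination haπC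
    rw [hmaC, hmaC2] at hS hD2 hvelC
    generalize Complex.exp (2 * Complex.I * (a * (X - y₀ t))) = w at *
    have hF : F ≠ 0 := left_ne_zero_of_mul_eq_one hFF
    have hw : (w + 1) / (Complex.I * (1 - w)) = (E + μ * F) / (Complex.I * (μ * F - E)) := by
      rw [← mul_div_mul_right _ _ (mul_ne_zero hμC hF), ← hratio]
      ring_nf
    rw [hw]
    refine velocity_of_exp_relations (D' := 2 * π * a * Complex.I * (E - E')) hD hEE hFF hne ?_
      hR1C hR2C ?_ ?_ rfl ?_
    · linear_combination 2 * Complex.I * hrj - (E' - E - ν * (F' - F)) * Complex.I_sq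
    · linear_combination 2 * hD2
    · linear_combination 2 * hvelC + 2 * v * hD2
    · linear_combination hS + (π - a) ^ 2 * hrj
  · have hy' : deriv y₀ t = c := by
      rw [show y₀ = fun t : ℝ => (c : ℂ) * (t : ℂ) - Complex.I * (β : ℂ) from funext hy₀]
      have h := ((Complex.ofRealCLM.hasDerivAt (x := t)).const_mul (c : ℂ)).sub_const
        (Complex.I * (β : ℂ))
      simpa using h.deriv
    have hne : ∀ i ∈ s, Complex.sin (a * (y₀ t - (x i t : ℂ))) ≠ 0 := by
      intro i _ h
      obtain ⟨k, hk⟩ := Complex.sin_eq_zero_iff.1 h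
      have := congrArg Complex.im hk
      simp [hy₀] at this
      rcases this with h | h
      · exact ha0.ne' h
      · exact hβ0 h
    have hfne : f (y₀ t) ≠ 0 := by
      rw [hfac]
      exact mul_ne_zero hK (Finset.prod_ne_zero_iff.2 hne)
    have h1 := hasDerivAt_mul_prod_sin K a (fun i => (x i t : ℂ)) hne
    rw [← funext hfac, ← hfac] at h1
    have h2 := (hfd (y₀ t)).unique h1
    rw [hy']
    refine mul_right_cancel₀ hfne (Eq.trans ?_ h2)
    have hratio : Complex.exp (((m + 2) * a * y₀ t - δ) * Complex.I) =
        μ * Complex.exp ((m * a * y₀ t + δ) * Complex.I) := by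
      rw [← hexpβ, ← Complex.exp_add, hy₀]
      congr 1
      linear_combination (-2 * a * β) * Complex.I_sq
    have hmaC : (m : ℂ) * a = π - a := by linear_combination haπC
    have hmaC2 : ((m : ℂ) + 2) * a = π + a := by linear_combination haπC
    simp only [hf, hf', Complex.sin, Complex.cos]
    rw [neg_mul, neg_mul, Complex.exp_neg, Complex.exp_neg, hratio, hmaC, hmaC2]
    have hF := Complex.exp_ne_zero (((π - a) * y₀ t + δ) * Complex.I)
    generalize Complex.exp (((π - a) * y₀ t + δ) * Complex.I) = F at *
    field_simp
    rw [Complex.I_sq]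
    linear_combination μ * F ^ 2 * hR1C + hR2C
end

section
/- Let a > 0, let n ≥ 2 be an integer, let σ: Fin n → {+1, −1} be a sign assignment, and let x: Fin n → ℝ → ℂ be differentiable functions such that for all j, k with j ≠ k and all t ∈ ℝ, sin(a(x_j(t) − x_k(t))) ≠ 0, and the unified Bäcklund equations i·ẋ_j(t) = a·Σ_{k≠j} σ_k·cot(a(x_j(t) − x_k(t))) hold for all j and t. Then each x_j is twice differentiable and satisfies the Calogero-Sutherland equations ẍ_j(t) = 2a³·Σ_{k≠j, σ_k = σ_j} cos(a(x_j(t) − x_k(t)))/sin³(a(x_j(t) − x_k(t))) for all j and t. -/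
open Real Filter Topology Finset

theorem Complex.cot_add_cot_eq_sin_div {u v : ℂ} (hu : Complex.sin u ≠ 0)
    (hv : Complex.sin v ≠ 0) :
    Complex.cot u + Complex.cot v = Complex.sin (u + v) / (Complex.sin u * Complex.sin v) := by
  rw [Complex.cot_eq_cos_div_sin, Complex.cot_eq_cos_div_sin, Complex.sin_add]
  field_simp
  ring

theorem Complex.cot_neg_eq_neg (u : ℂ) : Complex.cot (-u) = -Complex.cot u := by
  simp only [Complex.cot_eq_cos_div_sin, Complex.cos_neg, Complex.sin_neg, div_neg]

theorem Complex.hasDerivAt_cot {u : ℂ} (hu : Complex.sin u ≠ 0) :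
    HasDerivAt Complex.cot (-(Complex.sin u ^ 2)⁻¹) u := by
  have h := (Complex.hasDerivAt_cos u).div (Complex.hasDerivAt_sin u) hu
  have he : Complex.cot = Complex.cos / Complex.sin := by
    funext w
    exact Complex.cot_eq_cos_div_sin w
  rw [he]
  refine h.congr_deriv ?_
  field_simp
  linear_combination -Complex.sin_sq_add_cos_sq u

/-- The three-term cancellation: for distinct points the mixed terms of the double sum of
`1 / sin ^ 2` against differences of cotangents are antisymmetric. -/
theorem Complex.inv_sin_sq_mul_cot_sub_antisymm {u v w : ℂ} (huv : Complex.sin (u - v) ≠ 0)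
    (huw : Complex.sin (u - w) ≠ 0) (hvw : Complex.sin (v - w) ≠ 0) :
    (Complex.sin (u - v) ^ 2)⁻¹ * (Complex.cot (u - w) - Complex.cot (v - w))
      + (Complex.sin (u - w) ^ 2)⁻¹ * (Complex.cot (u - v) - Complex.cot (w - v)) = 0 := by
  have hwv : Complex.sin (w - v) ≠ 0 := by
    rwa [← neg_sub, Complex.sin_neg, neg_ne_zero]
  have h₁ : Complex.cot (u - w) - Complex.cot (v - w)
      = Complex.sin (u - v) / (Complex.sin (u - w) * Complex.sin (w - v)) := by
    rw [sub_eq_add_neg, ← Complex.cot_neg_eq_neg, neg_sub,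
      Complex.cot_add_cot_eq_sin_div huw hwv, sub_add_sub_cancel]
  have h₂ : Complex.cot (u - v) - Complex.cot (w - v)
      = -(Complex.sin (u - w) / (Complex.sin (u - v) * Complex.sin (w - v))) := by
    rw [sub_eq_add_neg, ← Complex.cot_neg_eq_neg, neg_sub,
      Complex.cot_add_cot_eq_sin_div huv hvw, sub_add_sub_cancel, ← neg_sub w v,
      Complex.sin_neg, mul_neg, div_neg]
  rw [h₁, h₂]
  field_simp
  ring

theorem sum_sum_inv_sin_sq_mul_cot_sub {ι : Type*} [Fintype ι] [DecidableEq ι] (σ : ι → ℂ)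
    (hσ : ∀ k, σ k * σ k = 1) (z : ι → ℂ)
    (hz : ∀ k l, k ≠ l → Complex.sin (z k - z l) ≠ 0) (j : ι) :
    ∑ k, ∑ l, σ k * σ l * ((Complex.sin (z j - z k) ^ 2)⁻¹
        * (Complex.cot (z j - z l) - Complex.cot (z k - z l)))
      = ∑ k, (1 + σ j * σ k)
        * ((Complex.sin (z j - z k) ^ 2)⁻¹ * Complex.cot (z j - z k)) := by
  set G : ι → ℂ := fun k => (Complex.sin (z j - z k) ^ 2)⁻¹ * Complex.cot (z j - z k) with hG
  set F : ι → ι → ℂ := fun k l => σ k * σ l * ((Complex.sin (z j - z k) ^ 2)⁻¹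
    * (Complex.cot (z j - z l) - Complex.cot (z k - z l))) with hF
  have cot_zero : Complex.cot 0 = 0 := by simp [Complex.cot_eq_cos_div_sin]
  have symm (k l : ι) : F k l + F l k = (if k = l then 2 * G k else 0)
      + (if k = j then σ j * σ l * G l else 0) + (if l = j then σ j * σ k * G k else 0) := by
    by_cases hkl : k = l
    · subst hkl
      by_cases hkj : k = j
      · subst hkj
        simp [hF, hG, cot_zero]
      · simp only [hF, hG, hkj, if_true, if_false, sub_self, cot_zero, hσ]
        ring
    by_cases hkj : k = j
    · subst hkj
      have hlk : l ≠ k := Ne.symm hkl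
      simp only [hF, hG, hkl, hlk, if_true, if_false, sub_self, cot_zero, Complex.sin_zero]
      rw [← neg_sub (z k) (z l), Complex.cot_neg_eq_neg]
      ring
    by_cases hlj : l = j
    · subst hlj
      simp only [hF, hG, hkl, if_true, if_false, sub_self, cot_zero, Complex.sin_zero]
      rw [← neg_sub (z l) (z k), Complex.cot_neg_eq_neg]
      ring
    · simp only [hF, hkl, hkj, hlj, if_false]
      linear_combination σ k * σ l * Complex.inv_sin_sq_mul_cot_sub_antisymm
        (hz j k (Ne.symm hkj)) (hz j l (Ne.symm hlj)) (hz k l hkl)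
  have hdouble : ∑ k, ∑ l, F k l + ∑ k, ∑ l, F k l = 2 * ∑ k, (1 + σ j * σ k) * G k := by
    nth_rewrite 2 [Finset.sum_comm]
    simp only [← Finset.sum_add_distrib, symm]
    simp only [Finset.sum_add_distrib, Finset.sum_ite_eq, Finset.sum_ite_eq', Finset.mem_univ,
      if_true, add_mul, one_mul, ← Finset.mul_sum, mul_add]
    rw [Finset.sum_comm (f := fun k l => if k = j then σ j * σ l * G l else 0)]
    simp only [Finset.sum_ite_eq', Finset.mem_univ, if_true]
    ring
  linear_combination hdouble / 2

/-- **Bäcklund transform implies Calogero-Sutherland equations.**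
Let `a > 0`, `n ≥ 2`, `σ : Fin n → {±1}`, and let `x_j : ℝ → ℂ` be differentiable
with `sin(a(x_j − x_k)) ≠ 0` for `j ≠ k`, satisfying the unified Bäcklund equations
`i ẋ_j = a Σ_{k≠j} σ_k cot(a(x_j − x_k))`.  Then each `x_j` is twice differentiable
and `ẍ_j = 2a³ Σ_{k≠j, σ_k=σ_j} cos(a(x_j − x_k))/sin³(a(x_j − x_k))`. -/
theorem backlund_implies_calogero_sutherland (a : ℝ) (ha : 0 < a)
    (n : ℕ) (hn : 2 ≤ n) (σ : Fin n → ℝ) (hσ : ∀ j, σ j = 1 ∨ σ j = -1)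
    (x : Fin n → ℝ → ℂ) (hdiff : ∀ j, Differentiable ℝ (x j))
    (hsin : ∀ (j k : Fin n), j ≠ k → ∀ t : ℝ,
      Complex.sin ((a : ℂ) * (x j t - x k t)) ≠ 0)
    (hback : ∀ (j : Fin n) (t : ℝ),
      Complex.I * deriv (x j) t
        = (a : ℂ) * ∑ k ∈ Finset.univ.erase j,
            (σ k : ℂ) * Complex.cot ((a : ℂ) * (x j t - x k t))) :
    ∀ (j : Fin n) (t : ℝ),
      HasDerivAt (deriv (x j))
        (2 * (a : ℂ) ^ 3 * ∑ k ∈ (Finset.univ.erase j).filter (fun k => σ k = σ j),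
          Complex.cos ((a : ℂ) * (x j t - x k t))
            / Complex.sin ((a : ℂ) * (x j t - x k t)) ^ 3) t := by
  intro j t
  have cot_zero : Complex.cot 0 = 0 := by simp [Complex.cot_eq_cos_div_sin]
  have hvel (j : Fin n) (t : ℝ) : deriv (x j) t
      = -Complex.I * ((a : ℂ) * ∑ k, (σ k : ℂ) * Complex.cot ((a : ℂ) * (x j t - x k t))) := by
    rw [← Finset.sum_erase Finset.univ (a := j) (by simp [cot_zero]), ← hback]
    linear_combination deriv (x j) t * Complex.I_mul_I
  have hcot (k : Fin n) : HasDerivAt (fun s => Complex.cot ((a : ℂ) * (x j s - x k s)))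
      (-(Complex.sin ((a : ℂ) * (x j t - x k t)) ^ 2)⁻¹
        * ((a : ℂ) * (deriv (x j) t - deriv (x k) t))) t := by
    by_cases hk : j = k
    · subst hk
      simp [hasDerivAt_const]
    · exact (Complex.hasDerivAt_cot (hsin j k hk t)).comp t
        (((hdiff j t).hasDerivAt.sub (hdiff k t).hasDerivAt).const_mul (a : ℂ))
  have hsum := ((HasDerivAt.fun_sum fun k (_ : k ∈ Finset.univ) =>
    (hcot k).const_mul (σ k : ℂ)).const_mul (a : ℂ)).const_mul (-Complex.I)
  rw [show deriv (x j) = _ from funext (hvel j)]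
  refine hsum.congr_deriv ?_
  have hσσ (k : Fin n) : (σ k : ℂ) * σ k = 1 := by
    rcases hσ k with h | h <;> simp [h]
  have key := sum_sum_inv_sin_sq_mul_cot_sub (fun k => (σ k : ℂ)) hσσ
    (fun k => (a : ℂ) * x k t) (fun k l h => by simpa only [mul_sub] using hsin k l h t) j
  simp only [← mul_sub] at key
  have hright : ∑ k, (1 + (σ j : ℂ) * σ k)
        * ((Complex.sin ((a : ℂ) * (x j t - x k t)) ^ 2)⁻¹
          * Complex.cot ((a : ℂ) * (x j t - x k t)))
      = 2 * ∑ k ∈ (Finset.univ.erase j).filter (fun k => σ k = σ j),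
          Complex.cos ((a : ℂ) * (x j t - x k t))
            / Complex.sin ((a : ℂ) * (x j t - x k t)) ^ 3 := by
    rw [Finset.sum_filter, ← Finset.sum_erase Finset.univ (a := j) (by simp), Finset.mul_sum]
    refine Finset.sum_congr rfl fun k hk => ?_
    have hs := hsin j k (Finset.ne_of_mem_erase hk).symm t
    rw [Complex.cot_eq_cos_div_sin]
    rcases hσ j with h | h <;> rcases hσ k with h' | h' <;> norm_num [h, h'] <;> field_simp
  rw [mul_right_comm, ← hright, ← key]
  simp only [Finset.mul_sum, Finset.sum_mul]
  refine Finset.sum_congr rfl fun k _ => ?_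
  rw [hvel j t, hvel k t, ← mul_sub, ← mul_sub, ← Finset.sum_sub_distrib]
  simp only [Finset.mul_sum]
  refine Finset.sum_congr rfl fun l _ => ?_
  generalize Complex.cot ((a : ℂ) * (x j t - x l t)) = c
  generalize Complex.cot ((a : ℂ) * (x k t - x l t)) = d
  generalize (Complex.sin ((a : ℂ) * (x j t - x k t)) ^ 2)⁻¹ = s
  linear_combination -(a : ℂ) ^ 3 * σ k * σ l * s * (c - d) * Complex.I_mul_I
end

section
/- Fix c > π. For each integer N ≥ 2 with c > π + a_N, where a_N = π/(N−1), let κ_N = (1+ν_N)/(1−ν_N) with ν_N = sqrt((c² − (π+a_N)²)/(c² − (π−a_N)²)), and let φ_N: ℝ → ℝ be the unique strictly increasing real-analytic function satisfying κ_N·tan(a_N(s − φ_N(s))) = tan(π·φ_N(s)) (where defined) and φ_N(s + N) = φ_N(s) + 1 for all s. Then for every δ with 0 < δ < π²/c² there exists N₀ such that for all N ≥ N₀ and all s ∈ ℝ, the derivative satisfies φ_N'(s) ≤ 1 − δ. -/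
open Real Filter Topology

/-- The cosine of a continuous function that gains `π` over some shift is not identically zero. -/
lemma exists_cos_ne_zero_of_shift {g : ℝ → ℝ} (hg : Continuous g) {T : ℝ}
    (hT : ∀ s, g (s + T) = g s + π) : ∃ s, Real.cos (g s) ≠ 0 := by
  have hshift : Real.sin (g (0 + T)) = -Real.sin (g 0) := by rw [hT, Real.sin_add_pi]
  obtain ⟨s, hs⟩ : ∃ s, Real.sin (g s) = 0 := by
    have hc : Continuous fun s => Real.sin (g s) := Real.continuous_sin.comp hg
    rcases le_total (Real.sin (g 0)) 0 with h | h
    · exact mem_range_of_exists_le_of_exists_ge hc ⟨0, h⟩ ⟨0 + T, by linarith⟩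
    · exact mem_range_of_exists_le_of_exists_ge hc ⟨0 + T, by linarith⟩ ⟨0, h⟩
  refine ⟨s, fun h => ?_⟩
  have := Real.sin_sq_add_cos_sq (g s)
  simp [hs, h] at this

/-- The tangent relation of a profile, cleared of denominators, holds on all of `ℝ`. -/
lemma IsProfile.mul_sin_mul_cos_eq {N : ℕ} {κ : ℝ} {φ : ℝ → ℝ} (h : IsProfile N κ φ)
    (hN : 2 ≤ N) (s : ℝ) :
    κ * Real.sin (π / ((N : ℝ) - 1) * (s - φ s)) * Real.cos (π * φ s)
      = Real.sin (π * φ s) * Real.cos (π / ((N : ℝ) - 1) * (s - φ s)) := by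
  obtain ⟨-, hφ, htan, hper⟩ := h
  have hN' : (2 : ℝ) ≤ N := by exact_mod_cast hN
  set a : ℝ := π / ((N : ℝ) - 1)
  have haN : a * ((N : ℝ) - 1) = π := div_mul_cancel₀ _ (by linarith)
  have hu : AnalyticOnNhd ℝ (fun s => a * (s - φ s)) Set.univ :=
    analyticOnNhd_const.mul (analyticOnNhd_id.sub hφ)
  have hv : AnalyticOnNhd ℝ (fun s => π * φ s) Set.univ := analyticOnNhd_const.mul hφ
  have hcu : AnalyticOnNhd ℝ (fun s => Real.cos (a * (s - φ s))) Set.univ :=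
    fun x hx => Real.analyticAt_cos.comp (hu x hx)
  have hcv : AnalyticOnNhd ℝ (fun s => Real.cos (π * φ s)) Set.univ :=
    fun x hx => Real.analyticAt_cos.comp (hv x hx)
  have hsu : AnalyticOnNhd ℝ (fun s => Real.sin (a * (s - φ s))) Set.univ :=
    fun x hx => Real.analyticAt_sin.comp (hu x hx)
  have hsv : AnalyticOnNhd ℝ (fun s => Real.sin (π * φ s)) Set.univ :=
    fun x hx => Real.analyticAt_sin.comp (hv x hx)
  have hF : AnalyticOnNhd ℝ (fun s => κ * Real.sin (a * (s - φ s)) * Real.cos (π * φ s)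
      - Real.sin (π * φ s) * Real.cos (a * (s - φ s))) Set.univ :=
    ((analyticOnNhd_const.mul hsu).mul hcv).sub (hsv.mul hcu)
  have hprod : ∀ x ∈ Set.univ, (fun s => Real.cos (a * (s - φ s))) x •
      ((fun s => Real.cos (π * φ s)) • fun s => κ * Real.sin (a * (s - φ s)) * Real.cos (π * φ s)
      - Real.sin (π * φ s) * Real.cos (a * (s - φ s))) x = 0 := by
    intro x _
    simp only [Pi.smul_apply', smul_eq_mul]
    by_cases h1 : Real.cos (a * (x - φ x)) = 0
    · simp [h1]
    by_cases h2 : Real.cos (π * φ x) = 0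
    · simp [h2]
    have := htan x h1 h2
    rw [Real.tan_eq_sin_div_cos, Real.tan_eq_sin_div_cos, ← mul_div_assoc, div_eq_div_iff h1 h2] at this
    rw [mul_eq_zero, mul_eq_zero]
    right; right; linarith
  rcases hcu.eq_zero_or_eq_zero_of_smul_eq_zero (hcv.smul hF) hprod isPreconnected_univ with h0 | h0
  · obtain ⟨t, ht⟩ := exists_cos_ne_zero_of_shift (g := fun s => a * (s - φ s)) (T := N)
      hu.continuous (fun s => by rw [hper]; linear_combination haN)
    exact absurd (h0 t trivial) ht
  rcases hcv.eq_zero_or_eq_zero_of_smul_eq_zero hF h0 isPreconnected_univ with h0 | h0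
  · obtain ⟨t, ht⟩ := exists_cos_ne_zero_of_shift (g := fun s => π * φ s) (T := N)
      hv.continuous (fun s => by rw [hper]; ring)
    exact absurd (h0 t trivial) ht
  · exact sub_eq_zero.1 (h0 s trivial)

/-- The slope bound for a differentiable solution of
`ν sin (a (s - φ s) + π φ s) = sin (π φ s - a (s - φ s))`. -/
lemma deriv_mul_le_of_sin_relation {a ν : ℝ} (ha : 0 < a) (hν0 : 0 ≤ ν) (hν1 : ν < 1)
    {φ : ℝ → ℝ} (hφ : Differentiable ℝ φ)
    (h : ∀ s, ν * Real.sin (a * (s - φ s) + π * φ s) = Real.sin (π * φ s - a * (s - φ s)))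
    (s : ℝ) : deriv φ s * (π * (1 - ν) + a * (1 + ν)) ≤ a * (1 + ν) := by
  have hd := (hφ s).hasDerivAt
  set p := deriv φ s
  have hu : HasDerivAt (fun s => a * (s - φ s)) (a * (1 - p)) s :=
    ((hasDerivAt_id s).sub hd).const_mul a
  have hv : HasDerivAt (fun s => π * φ s) (π * p) s := hd.const_mul π
  have hL := ((hu.add hv).sin).const_mul ν
  have hR := (hv.sub hu).sin
  have hLR := hL.unique (hR.congr_of_eventuallyEq (Eventually.of_forall h))
  have hs := h s
  simp only [Pi.add_apply, Pi.sub_apply] at hLR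
  have hC := Real.sin_sq_add_cos_sq (a * (s - φ s) + π * φ s)
  have hD := Real.sin_sq_add_cos_sq (π * φ s - a * (s - φ s))
  rw [← hs] at hD
  set C := Real.cos (a * (s - φ s) + π * φ s)
  set D := Real.cos (π * φ s - a * (s - φ s))
  set S := Real.sin (a * (s - φ s) + π * φ s)
  have hν2 : ν ^ 2 < 1 := by nlinarith
  have hDC : D ^ 2 = 1 - ν ^ 2 + ν ^ 2 * C ^ 2 := by linear_combination hD - ν ^ 2 * hC
  have hD0 : D ≠ 0 := by
    rintro h0
    rw [h0] at hDC
    nlinarith [mul_nonneg (sq_nonneg ν) (sq_nonneg C)]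
  obtain ⟨x, hx⟩ : ∃ x, ν * C = x * D := ⟨ν * C / D, by field_simp⟩
  have hCD : C ^ 2 ≤ D ^ 2 := by
    nlinarith [mul_nonneg (sub_nonneg.2 hν2.le) (sq_nonneg S)]
  have hxν : |x| ≤ ν := by
    apply abs_le_of_sq_le_sq _ hν0
    have h1 : x ^ 2 * D ^ 2 ≤ ν ^ 2 * D ^ 2 := by
      rw [← mul_pow, ← hx, mul_pow]
      exact mul_le_mul_of_nonneg_left hCD (sq_nonneg ν)
    exact le_of_mul_le_mul_right h1 (by positivity)
  obtain ⟨hx1, hx2⟩ := abs_le.1 hxν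
  have hp : p * (π * (1 - x) + a * (1 + x)) = a * (1 + x) := by
    apply mul_right_cancel₀ hD0
    linear_combination -hLR + (a * (1 - p) + π * p) * hx
  have hE : 0 < π * (1 - x) + a * (1 + x) :=
    add_pos (mul_pos Real.pi_pos (by linarith)) (mul_pos ha (by linarith))
  refine le_of_mul_le_mul_right ?_ hE
  have : p * (π * (1 - ν) + a * (1 + ν)) * (π * (1 - x) + a * (1 + x))
      = a * (1 + x) * (π * (1 - ν) + a * (1 + ν)) := by
    linear_combination (π * (1 - ν) + a * (1 + ν)) * hp
  rw [this]
  nlinarith [mul_nonneg (mul_pos ha Real.pi_pos).le (sub_nonneg.2 hx2)]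

/-- **Uniform subsonic bound on the profile slope.**
Fix `c > π`.  For `N ≥ 2` with `c > π + a_N` (`a_N = π/(N−1)`), let `φ_N` be the
periodic wave profile with parameter `κ_N = (1+ν_N)/(1−ν_N)`,
`ν_N = √((c² − (π+a_N)²)/(c² − (π−a_N)²))`.  Then for every `0 < δ < π²/c²` there
is `N₀` such that `φ_N'(s) ≤ 1 − δ` for all `N ≥ N₀` and all `s ∈ ℝ`. -/
theorem profile_slope_bound (c : ℝ) (hc : π < c) (δ : ℝ) (hδ0 : 0 < δ)
    (hδ : δ < π ^ 2 / c ^ 2) :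
    ∃ N₀ : ℕ, ∀ N : ℕ, N₀ ≤ N → 2 ≤ N → c > π + π / ((N : ℝ) - 1) →
      ∀ κ ν : ℝ,
        ν = Real.sqrt ((c ^ 2 - (π + π / ((N : ℝ) - 1)) ^ 2)
          / (c ^ 2 - (π - π / ((N : ℝ) - 1)) ^ 2)) →
        κ = (1 + ν) / (1 - ν) →
        ∀ φ : ℝ → ℝ, IsProfile N κ φ →
          ∀ s : ℝ, deriv φ s ≤ 1 - δ := by
  have hπ := Real.pi_pos
  have hc0 : 0 < c := hπ.trans hc
  have hη : 0 < π ^ 2 - δ * c ^ 2 := by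
    rw [lt_div_iff₀ (by positivity)] at hδ
    linarith
  obtain ⟨n, hn⟩ := exists_nat_ge (2 * π ^ 2 * δ / (π ^ 2 - δ * c ^ 2))
  refine ⟨n + 1, fun N hnN hN hcN κ ν hν hκ φ hφ s => ?_⟩
  have hrel := hφ.mul_sin_mul_cos_eq hN
  have hN2 : (2 : ℝ) ≤ N := by exact_mod_cast hN
  have hnN' : (n : ℝ) ≤ (N : ℝ) - 1 := by
    have : (n : ℝ) + 1 ≤ N := by exact_mod_cast hnN
    linarith
  have haN : π / ((N : ℝ) - 1) * ((N : ℝ) - 1) = π := div_mul_cancel₀ _ (by linarith)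
  have ha : 0 < π / ((N : ℝ) - 1) := div_pos hπ (by linarith)
  set a : ℝ := π / ((N : ℝ) - 1)
  have hδa : δ * (c ^ 2 + 2 * π * a) ≤ π ^ 2 := by
    have h1 : 2 * π ^ 2 * δ ≤ ((N : ℝ) - 1) * (π ^ 2 - δ * c ^ 2) :=
      (div_le_iff₀ hη).1 (hn.trans hnN')
    have h2 := mul_le_mul_of_nonneg_left h1 ha.le
    have h3 : a * (((N : ℝ) - 1) * (π ^ 2 - δ * c ^ 2)) = π * (π ^ 2 - δ * c ^ 2) := by
      rw [← mul_assoc, haN]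
    rw [h3] at h2
    have h4 : π * (2 * π * a * δ) ≤ π * (π ^ 2 - δ * c ^ 2) := by linarith
    linarith [le_of_mul_le_mul_left h4 hπ]
  have hP : 0 < c ^ 2 - (π + a) ^ 2 := by nlinarith
  have haπ : 0 < π * a := mul_pos hπ ha
  have hQ : 0 < c ^ 2 - (π - a) ^ 2 := by nlinarith
  have hν0 : 0 ≤ ν := hν ▸ Real.sqrt_nonneg _
  have hνQ : ν ^ 2 * (c ^ 2 - (π - a) ^ 2) = c ^ 2 - (π + a) ^ 2 := by
    rw [hν, Real.sq_sqrt (div_pos hP hQ).le, div_mul_cancel₀ _ hQ.ne']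
  have hν1 : ν < 1 := by
    by_contra! hge
    nlinarith [mul_nonneg (by nlinarith : 0 ≤ ν ^ 2 - 1) hQ.le]
  have hsin : ∀ s, ν * Real.sin (a * (s - φ s) + π * φ s)
      = Real.sin (π * φ s - a * (s - φ s)) := by
    intro s
    have h := hrel s
    rw [hκ] at h
    have h1 : 1 - ν ≠ 0 := by linarith
    have h2 : (1 + ν) / (1 - ν) * (1 - ν) = 1 + ν := div_mul_cancel₀ _ h1
    rw [Real.sin_add, Real.sin_sub]
    linear_combination (1 - ν) * h
      - Real.sin (a * (s - φ s)) * Real.cos (π * φ s) * h2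
  have hdiff : Differentiable ℝ φ := fun x => (hφ.2.1 x trivial).differentiableAt
  have hmain := deriv_mul_le_of_sin_relation ha hν0 hν1 hdiff hsin s
  have hE : 0 < π * (1 - ν) + a * (1 + ν) :=
    add_pos (mul_pos hπ (by linarith)) (mul_pos ha (by linarith))
  have hkey : π * a * (1 + ν) ≤ (1 - ν) * (c ^ 2 - π ^ 2 + 2 * π * a) := by
    refine le_of_mul_le_mul_right (a := 1 + ν) ?_ (by linarith)
    have h1 : (1 + ν) ^ 2 ≤ 4 := by nlinarith
    have h2 : 0 ≤ (1 - ν ^ 2) * a ^ 2 := mul_nonneg (by nlinarith) (sq_nonneg a)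
    nlinarith [mul_le_mul_of_nonneg_left h1 haπ.le]
  have hδE : δ * (π * (1 - ν) + a * (1 + ν)) ≤ π * (1 - ν) := by
    refine le_of_mul_le_mul_left (a := π) ?_ hπ
    have h1 : π * (π * (1 - ν) + a * (1 + ν)) ≤ (1 - ν) * (c ^ 2 + 2 * π * a) := by linarith
    nlinarith [mul_le_mul_of_nonneg_left h1 hδ0.le,
      mul_le_mul_of_nonneg_left hδa (by linarith : 0 ≤ 1 - ν)]
  refine le_of_mul_le_mul_right ?_ hE
  linarith
end
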